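/- arXiv:2002.03296 — 4 statements merged into one kernel-verified Lean document; each statement's English description precedes it below -/
import Mathlib

section
/- For all 0 < α ≤ 1/2 and 0 < β ≤ 1/2: limsup_{n→∞} Γ_S^(n)(⌊α·2^n⌋, 2⌊βn/2⌋+1) ≤ α^{1/(1−β)}; limsup_{n→∞} Γ_B^(n)(⌊α·2^n⌋, 2⌊βn/2⌋+1) ≤ α^{1/(1−β)}; limsup_{n→∞} Γ_S^(n)(⌊α·2^n⌋, 2⌊βn/2⌋) ≤ 2·α^{1/(1−β)}; and limsup_{n→∞} Γ_B^(n)(⌊α·2^n⌋, 2⌊βn/2⌋) ≤ 2(1−β)·α^{1/(1−β)}. -/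
open Finset

noncomputable section

/-- The Hamming ball of radius `r` around the all-ones vector in `{-1,1}^n`
(vertices modeled as `Fin n → ℤˣ`, where `ℤˣ = {1, -1}`). -/
def hBall (n r : ℕ) : Finset (Fin n → ℤˣ) :=
  Finset.univ.filter fun z => hammingDist z 1 ≤ r

/-- The Hamming sphere of radius `r` around the all-ones vector. -/
def hSphere (n r : ℕ) : Finset (Fin n → ℤˣ) :=
  Finset.univ.filter fun z => hammingDist z 1 = r

/-- Ball-noise stability `E[f(X) f(X∘Z)]`, `X` uniform on the cube, `Z` uniform on `B_r`. -/
def BStab (n r : ℕ) (f : (Fin n → ℤˣ) → ℝ) : ℝ :=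
  (∑ x : Fin n → ℤˣ, ∑ z ∈ hBall n r, f x * f (x * z)) / (2 ^ n * (hBall n r).card)

/-- Sphere-noise stability `E[f(X) f(X∘Z)]`, `X` uniform on the cube, `Z` uniform on `S_r`. -/
def SStab (n r : ℕ) (f : (Fin n → ℤˣ) → ℝ) : ℝ :=
  (∑ x : Fin n → ℤˣ, ∑ z ∈ hSphere n r, f x * f (x * z)) / (2 ^ n * (hSphere n r).card)

/-- i.i.d.-noise stability `E[f(X) f(X∘Z)]`, `Z` with i.i.d. coordinates equal to `-1`
with probability `β` and `1` with probability `1-β`. -/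
def Stab (n : ℕ) (β : ℝ) (f : (Fin n → ℤˣ) → ℝ) : ℝ :=
  (∑ x : Fin n → ℤˣ, ∑ z : Fin n → ℤˣ,
      (∏ i, if z i = 1 then 1 - β else β) * (f x * f (x * z))) / 2 ^ n

/-- Indicator function of a set `A` of vertices. -/
def indic (n : ℕ) (A : Finset (Fin n → ℤˣ)) : (Fin n → ℤˣ) → ℝ :=
  fun x => if x ∈ A then 1 else 0

/-- `Γ_B^(n)(M,r)`: maximal ball-noise stability over Boolean functions with exactly `M` ones. -/
def GammaB (n M r : ℕ) : ℝ :=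
  sSup {y | ∃ A : Finset (Fin n → ℤˣ), A.card = M ∧ y = BStab n r (indic n A)}

/-- `Γ_S^(n)(M,r)`: maximal sphere-noise stability over Boolean functions with exactly `M` ones. -/
def GammaS (n M r : ℕ) : ℝ :=
  sSup {y | ∃ A : Finset (Fin n → ℤˣ), A.card = M ∧ y = SStab n r (indic n A)}

/-- `Γ_IID^(n)(M,β)`: maximal i.i.d.-noise stability over Boolean functions with exactly `M` ones. -/
def GammaIID (n M : ℕ) (β : ℝ) : ℝ :=
  sSup {y | ∃ A : Finset (Fin n → ℤˣ), A.card = M ∧ y = Stab n β (indic n A)}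

/-- `Γ_IID(α,β) := sup_n Γ_IID^(n)(⌊α·2^n⌋, β)` (equivalently the limit, by monotonicity). -/
def GammaIIDlim (α β : ℝ) : ℝ := ⨆ n : ℕ, GammaIID n ⌊α * 2 ^ n⌋₊ β

/-- `C(n, ≤ r) = Σ_{i=0}^r C(n,i)`. -/
def ballBinom (n r : ℕ) : ℕ := ∑ i ∈ Finset.range (r + 1), n.choose i

/-- A difference bound for powers with exponent in `[0, 1]`. -/
theorem two_mul_le_rpow_sub_rpow {s y : ℝ} (hs0 : 0 ≤ s) (hs1 : s ≤ 1) (hy0 : 0 ≤ y)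
    (hy1 : y ≤ 1) : 2 * s * y ≤ (1 + y) ^ s - (1 - y) ^ s := by
  rcases hs0.eq_or_lt with rfl | hs
  · simp
  have hmono : MonotoneOn (fun t : ℝ => (1 + t) ^ s - (1 - t) ^ s - 2 * s * t)
      (Set.Icc 0 1) := by
    apply monotoneOn_of_hasDerivWithinAt_nonneg (convex_Icc 0 1)
      (f' := fun t => s * (1 + t) ^ (s - 1) + s * (1 - t) ^ (s - 1) - 2 * s)
    · apply ContinuousOn.sub
      · apply ContinuousOn.sub
        · exact ContinuousOn.rpow_const (by fun_prop) (fun _ _ => Or.inr hs0)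
        · exact ContinuousOn.rpow_const (by fun_prop) (fun _ _ => Or.inr hs0)
      · fun_prop
    · intro t ht
      rw [interior_Icc] at ht
      apply HasDerivAt.hasDerivWithinAt
      have h1 : HasDerivAt (fun t : ℝ => (1 + t) ^ s) (1 * s * (1 + t) ^ (s - 1)) t :=
        HasDerivAt.rpow_const ((hasDerivAt_id t).const_add 1) (Or.inl (by linarith [ht.1]))
      have h2 : HasDerivAt (fun t : ℝ => (1 - t) ^ s) (-1 * s * (1 - t) ^ (s - 1)) t :=
        HasDerivAt.rpow_const ((hasDerivAt_id t).const_sub 1) (Or.inl (by linarith [ht.2]))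
      exact ((h1.sub h2).sub ((hasDerivAt_id t).const_mul (2 * s))).congr_deriv (by ring)
    · intro t ht
      rw [interior_Icc] at ht
      have hp : 0 < 1 + t := by linarith [ht.1]
      have hm : 0 < 1 - t := by linarith [ht.2]
      have hprod : 1 ≤ (1 + t) ^ (s - 1) * (1 - t) ^ (s - 1) := by
        rw [← Real.mul_rpow hp.le hm.le]
        exact Real.one_le_rpow_of_pos_of_le_one_of_nonpos (by positivity)
          (by nlinarith [ht.1]) (by linarith)
      have hA : 0 < (1 + t) ^ (s - 1) := by positivity
      have hB : 0 < (1 - t) ^ (s - 1) := by positivity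
      have hsum : 2 ≤ (1 + t) ^ (s - 1) + (1 - t) ^ (s - 1) := by
        nlinarith [sq_nonneg ((1 + t) ^ (s - 1) - (1 - t) ^ (s - 1))]
      nlinarith
  have h := hmono (Set.left_mem_Icc.2 zero_le_one) (Set.mem_Icc.2 ⟨hy0, hy1⟩) hy0
  simp at h
  linarith

theorem one_add_sq_le_rpow_mean {s y : ℝ} (hs0 : 0 ≤ s) (hs1 : s ≤ 1) (hy0 : 0 ≤ y)
    (hy1 : y ≤ 1) :
    1 + (1 + s) / 2 * (s * y ^ 2) ≤ ((1 + y) ^ (1 + s) + (1 - y) ^ (1 + s)) / 2 := by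
  have hmono : MonotoneOn (fun t : ℝ => ((1 + t) ^ (1 + s) + (1 - t) ^ (1 + s)) / 2
      - (1 + s) / 2 * (s * t ^ 2)) (Set.Icc 0 1) := by
    apply monotoneOn_of_hasDerivWithinAt_nonneg (convex_Icc 0 1)
      (f' := fun t => (1 + s) / 2 * ((1 + t) ^ s - (1 - t) ^ s - 2 * s * t))
    · apply ContinuousOn.sub
      · apply ContinuousOn.div_const
        apply ContinuousOn.add
        · exact ContinuousOn.rpow_const (by fun_prop) (fun _ _ => Or.inr (by linarith))
        · exact ContinuousOn.rpow_const (by fun_prop) (fun _ _ => Or.inr (by linarith))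
      · fun_prop
    · intro t ht
      apply HasDerivAt.hasDerivWithinAt
      have h1 : HasDerivAt (fun t : ℝ => (1 + t) ^ (1 + s))
          (1 * (1 + s) * (1 + t) ^ (1 + s - 1)) t :=
        HasDerivAt.rpow_const ((hasDerivAt_id t).const_add 1) (Or.inr (by linarith))
      have h2 : HasDerivAt (fun t : ℝ => (1 - t) ^ (1 + s))
          (-1 * (1 + s) * (1 - t) ^ (1 + s - 1)) t :=
        HasDerivAt.rpow_const ((hasDerivAt_id t).const_sub 1) (Or.inr (by linarith))
      rw [add_sub_cancel_left] at h1 h2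
      exact (((h1.add h2).div_const 2).sub
        (((hasDerivAt_pow 2 t).const_mul s).const_mul ((1 + s) / 2))).congr_deriv
        (by push_cast; ring)
    · intro t ht
      rw [interior_Icc] at ht
      have := two_mul_le_rpow_sub_rpow hs0 hs1 ht.1.le ht.2.le
      exact mul_nonneg (by linarith) (by linarith)
  have h := hmono (Set.left_mem_Icc.2 zero_le_one) (Set.mem_Icc.2 ⟨hy0, hy1⟩) hy0
  simp at h
  linarith

/-- The two-point hypercontractive inequality, in terms of mean and half-difference. -/
theorem sq_add_mul_sq_le_rpow_mean {s u v : ℝ} (hs0 : 0 ≤ s) (hs1 : s ≤ 1) (hv : 0 ≤ v)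
    (huv : v ≤ u) :
    u ^ 2 + s * v ^ 2 ≤
      (((u + v) ^ (1 + s) + (u - v) ^ (1 + s)) / 2) ^ (2 / (1 + s)) := by
  rcases (hv.trans huv).eq_or_lt with rfl | hu
  · obtain rfl : v = 0 := le_antisymm huv hv
    simp
    positivity
  obtain ⟨y, rfl⟩ : ∃ y, v = u * y := ⟨v / u, by field_simp⟩
  have hy0 : 0 ≤ y := nonneg_of_mul_nonneg_right hv hu
  have hy1 : y ≤ 1 := by nlinarith
  have hp : 0 < 1 + s := by linarith
  have hmean : ((u + u * y) ^ (1 + s) + (u - u * y) ^ (1 + s)) / 2 =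
      u ^ (1 + s) * (((1 + y) ^ (1 + s) + (1 - y) ^ (1 + s)) / 2) := by
    rw [show u + u * y = u * (1 + y) by ring, show u - u * y = u * (1 - y) by ring,
      Real.mul_rpow hu.le (by linarith), Real.mul_rpow hu.le (by linarith)]
    ring
  have hmean0 : 0 ≤ ((1 + y) ^ (1 + s) + (1 - y) ^ (1 + s)) / 2 := by
    have h1 : 0 ≤ 1 - y := by linarith
    positivity
  have hbase : 1 + s * y ^ 2 ≤
      (((1 + y) ^ (1 + s) + (1 - y) ^ (1 + s)) / 2) ^ (2 / (1 + s)) := by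
    have hb : (1 + s * y ^ 2) ^ ((1 + s) / 2) ≤ 1 + (1 + s) / 2 * (s * y ^ 2) :=
      rpow_one_add_le_one_add_mul_self (by nlinarith [mul_nonneg hs0 (sq_nonneg y)])
        (by linarith) (by linarith)
    calc 1 + s * y ^ 2 = ((1 + s * y ^ 2) ^ ((1 + s) / 2)) ^ (2 / (1 + s)) := by
          rw [← Real.rpow_mul (by positivity)]
          rw [show (1 + s) / 2 * (2 / (1 + s)) = 1 by field_simp, Real.rpow_one]
      _ ≤ _ := Real.rpow_le_rpow (by positivity)
          (hb.trans (one_add_sq_le_rpow_mean hs0 hs1 hy0 hy1)) (by positivity)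
  rw [hmean, Real.mul_rpow (by positivity) hmean0, ← Real.rpow_mul hu.le,
    show (1 + s) * (2 / (1 + s)) = ((2 : ℕ) : ℝ) by field_simp; norm_num, Real.rpow_natCast]
  nlinarith [mul_le_mul_of_nonneg_left hbase (sq_nonneg u)]

theorem two_point_quadratic_le {β a b : ℝ} (hβ0 : 0 ≤ β) (hβ : β ≤ 1 / 2) (ha : 0 ≤ a)
    (hb : 0 ≤ b) :
    (1 - β) * (a ^ 2 + b ^ 2) + 2 * β * (a * b) ≤
      2 * ((a ^ (2 * (1 - β)) + b ^ (2 * (1 - β))) / 2) ^ (1 / (1 - β)) := by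
  wlog hab : b ≤ a generalizing a b
  · have := this hb ha (le_of_not_ge hab)
    rw [add_comm (a ^ (2 * (1 - β)))]
    linarith
  have h := sq_add_mul_sq_le_rpow_mean (s := 1 - 2 * β) (u := (a + b) / 2) (v := (a - b) / 2)
    (by linarith) (by linarith) (by linarith) (by linarith)
  have h1 : (1 : ℝ) - β ≠ 0 := by linarith
  rw [show (a + b) / 2 + (a - b) / 2 = a by ring, show (a + b) / 2 - (a - b) / 2 = b by ring,
    show 1 + (1 - 2 * β) = 2 * (1 - β) by ring,
    show 2 / (2 * (1 - β)) = 1 / (1 - β) by field_simp] at h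
  nlinarith

/-- The two-function form of the two-point hypercontractive inequality. -/
theorem two_point_bilinear_le {β a b c d : ℝ} (hβ0 : 0 ≤ β) (hβ : β ≤ 1 / 2) (ha : 0 ≤ a)
    (hb : 0 ≤ b) (hc : 0 ≤ c) (hd : 0 ≤ d) :
    (1 - β) * (a * c + b * d) + β * (a * d + b * c) ≤
      2 * (((a ^ (2 * (1 - β)) + b ^ (2 * (1 - β))) / 2) ^ (1 / (2 * (1 - β))) *
        ((c ^ (2 * (1 - β)) + d ^ (2 * (1 - β))) / 2) ^ (1 / (2 * (1 - β)))) := by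
  have h1 := two_point_quadratic_le hβ0 hβ ha hb
  have h2 := two_point_quadratic_le hβ0 hβ hc hd
  have hβ' : (1 : ℝ) - β ≠ 0 := by linarith
  have key : ∀ t : ℝ, 0 ≤ t → t ^ (1 / (1 - β)) = (t ^ (1 / (2 * (1 - β)))) ^ 2 := by
    intro t ht
    rw [← Real.rpow_natCast, ← Real.rpow_mul ht]
    congr 1
    field_simp
    norm_num
  rw [key _ (by positivity)] at h1 h2
  have hA : 0 ≤ ((a ^ (2 * (1 - β)) + b ^ (2 * (1 - β))) / 2) ^ (1 / (2 * (1 - β))) := by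
    positivity
  have hB : 0 ≤ ((c ^ (2 * (1 - β)) + d ^ (2 * (1 - β))) / 2) ^ (1 / (2 * (1 - β))) := by
    positivity
  generalize ((a ^ (2 * (1 - β)) + b ^ (2 * (1 - β))) / 2) ^ (1 / (2 * (1 - β))) = A at *
  generalize ((c ^ (2 * (1 - β)) + d ^ (2 * (1 - β))) / 2) ^ (1 / (2 * (1 - β))) = B at *
  have hL : 0 ≤ (1 - β) * (a * c + b * d) + β * (a * d + b * c) := by
    have : 0 ≤ 1 - β := by linarith
    positivity
  refine abs_le_of_sq_le_sq' ?_ (by positivity) |>.2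
  calc _ ≤ ((1 - β) * (a ^ 2 + b ^ 2) + 2 * β * (a * b)) *
        ((1 - β) * (c ^ 2 + d ^ 2) + 2 * β * (c * d)) := by
        have : 0 ≤ 1 - 2 * β := by linarith
        nlinarith [mul_nonneg this (sq_nonneg (a * d - b * c))]
    _ ≤ (2 * A ^ 2) * (2 * B ^ 2) := by
        apply mul_le_mul h1 h2 _ (by positivity)
        have : 0 ≤ 1 - β := by linarith
        positivity
    _ = _ := by ring

theorem sum_units_cons {n : ℕ} (F : (Fin (n + 1) → ℤˣ) → ℝ) :
    ∑ x, F x = ∑ y : Fin n → ℤˣ, F (Fin.cons 1 y) + ∑ y : Fin n → ℤˣ, F (Fin.cons (-1) y) := by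
  rw [← (Fin.consEquiv (fun _ : Fin (n + 1) => ℤˣ)).sum_comp, Fintype.sum_prod_type,
    UnitsInt.univ, Finset.sum_pair (by decide)]
  rfl

theorem units_cons_mul_cons {n : ℕ} (a b : ℤˣ) (x y : Fin n → ℤˣ) :
    (Fin.cons a x * Fin.cons b y : Fin (n + 1) → ℤˣ) = Fin.cons (a * b) (x * y) := by
  funext i
  refine Fin.cases ?_ (fun j => ?_) i <;> simp

/-- Two-function hypercontractivity on the discrete cube, for nonnegative functions. -/
theorem noise_bilinear_le {β : ℝ} (hβ0 : 0 ≤ β) (hβ : β ≤ 1 / 2) (n : ℕ)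
    (f g : (Fin n → ℤˣ) → ℝ) (hf : ∀ x, 0 ≤ f x) (hg : ∀ x, 0 ≤ g x) :
    (∑ x : Fin n → ℤˣ, ∑ z : Fin n → ℤˣ,
      (∏ i, if z i = 1 then 1 - β else β) * (f x * g (x * z))) / 2 ^ n ≤
    ((∑ x, f x ^ (2 * (1 - β))) / 2 ^ n) ^ (1 / (2 * (1 - β))) *
      ((∑ x, g x ^ (2 * (1 - β))) / 2 ^ n) ^ (1 / (2 * (1 - β))) := by
  have hp : 2 * (1 - β) ≠ 0 := by linarith
  have hβ' : 0 ≤ 1 - β := by linarith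
  induction n with
  | zero =>
    simp only [Fintype.sum_unique, Finset.univ_eq_empty, Finset.prod_empty, pow_zero, div_one,
      one_mul, one_div]
    rw [Real.rpow_rpow_inv (hf _) hp, Real.rpow_rpow_inv (hg _) hp]
    exact le_of_eq (congrArg _ (congrArg g (Subsingleton.elim _ _)))
  | succ n ih =>
    set p := 2 * (1 - β) with hpdef
    have norm_cons : ∀ h : (Fin (n + 1) → ℤˣ) → ℝ, (∀ x, 0 ≤ h x) →
        (∑ x, h x ^ p) / 2 ^ (n + 1) =
          ((((∑ y : Fin n → ℤˣ, h (Fin.cons 1 y) ^ p) / 2 ^ n) ^ (1 / p)) ^ p +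
            (((∑ y : Fin n → ℤˣ, h (Fin.cons (-1) y) ^ p) / 2 ^ n) ^ (1 / p)) ^ p) / 2 := by
      intro h hh
      have hnn : ∀ a, 0 ≤ (∑ y : Fin n → ℤˣ, h (Fin.cons a y) ^ p) / 2 ^ n := fun a =>
        div_nonneg (Finset.sum_nonneg fun y _ => Real.rpow_nonneg (hh _) _) (by positivity)
      rw [one_div, Real.rpow_inv_rpow (hnn _) hp, Real.rpow_inv_rpow (hnn _) hp,
        sum_units_cons, pow_succ]
      field_simp
    have norm_nonneg : ∀ h : (Fin (n + 1) → ℤˣ) → ℝ, (∀ x, 0 ≤ h x) → ∀ a,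
        0 ≤ ((∑ y : Fin n → ℤˣ, h (Fin.cons a y) ^ p) / 2 ^ n) ^ (1 / p) := fun h hh a =>
      Real.rpow_nonneg (div_nonneg (Finset.sum_nonneg fun y _ => Real.rpow_nonneg (hh _) _)
        (by positivity)) _
    rw [norm_cons f hf, norm_cons g hg]
    have key := two_point_bilinear_le hβ0 hβ (norm_nonneg f hf 1) (norm_nonneg f hf (-1))
      (norm_nonneg g hg 1) (norm_nonneg g hg (-1))
    rw [← hpdef] at key
    have slice := fun a b : ℤˣ => ih (fun y => f (Fin.cons a y)) (fun y => g (Fin.cons b y))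
      (fun _ => hf _) (fun _ => hg _)
    have expand : (∑ x : Fin (n + 1) → ℤˣ, ∑ z : Fin (n + 1) → ℤˣ,
        (∏ i, if z i = 1 then 1 - β else β) * (f x * g (x * z))) / 2 ^ (n + 1) =
        ((1 - β) * ((∑ x : Fin n → ℤˣ, ∑ z : Fin n → ℤˣ, (∏ i, if z i = 1 then 1 - β else β) *
            (f (Fin.cons 1 x) * g (Fin.cons 1 (x * z)))) / 2 ^ n +
          (∑ x : Fin n → ℤˣ, ∑ z : Fin n → ℤˣ, (∏ i, if z i = 1 then 1 - β else β) *
            (f (Fin.cons (-1) x) * g (Fin.cons (-1) (x * z)))) / 2 ^ n) +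
        β * ((∑ x : Fin n → ℤˣ, ∑ z : Fin n → ℤˣ, (∏ i, if z i = 1 then 1 - β else β) *
            (f (Fin.cons 1 x) * g (Fin.cons (-1) (x * z)))) / 2 ^ n +
          (∑ x : Fin n → ℤˣ, ∑ z : Fin n → ℤˣ, (∏ i, if z i = 1 then 1 - β else β) *
            (f (Fin.cons (-1) x) * g (Fin.cons 1 (x * z)))) / 2 ^ n)) / 2 := by
      simp only [sum_units_cons, units_cons_mul_cons, Fin.prod_univ_succ, Fin.cons_zero,
        Fin.cons_succ, if_true, mul_assoc, Finset.sum_add_distrib, ← Finset.mul_sum,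
        show (-1 : ℤˣ) ≠ 1 by decide, if_false, mul_one, one_mul, neg_mul_neg]
      rw [pow_succ]
      field_simp
    rw [expand]
    have h11 := mul_le_mul_of_nonneg_left (slice 1 1) hβ'
    have h22 := mul_le_mul_of_nonneg_left (slice (-1) (-1)) hβ'
    have h12 := mul_le_mul_of_nonneg_left (slice 1 (-1)) hβ0
    have h21 := mul_le_mul_of_nonneg_left (slice (-1) 1) hβ0
    linarith

theorem indic_nonneg {n : ℕ} (A : Finset (Fin n → ℤˣ)) (x : Fin n → ℤˣ) : 0 ≤ indic n A x := by
  unfold indic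
  split_ifs <;> simp

theorem stab_indic_le {β : ℝ} (hβ0 : 0 ≤ β) (hβ : β ≤ 1 / 2) (n : ℕ)
    (A : Finset (Fin n → ℤˣ)) :
    Stab n β (indic n A) ≤ ((A.card : ℝ) / 2 ^ n) ^ (1 / (1 - β)) := by
  have hp : 2 * (1 - β) ≠ 0 := by linarith
  have h := noise_bilinear_le hβ0 hβ n (indic n A) (indic n A) (indic_nonneg A)
    (indic_nonneg A)
  have hsum : ∑ x, indic n A x ^ (2 * (1 - β)) = A.card := by
    simp [indic, Real.zero_rpow hp, apply_ite (fun t : ℝ => t ^ (2 * (1 - β)))]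
  rw [hsum] at h
  refine h.trans (le_of_eq ?_)
  rw [← sq, ← Real.rpow_natCast, ← Real.rpow_mul (by positivity)]
  congr 1
  have : (1 : ℝ) - β ≠ 0 := by linarith
  field_simp
  norm_num

/-- The character of `{-1,1}^n` indexed by a set of coordinates. -/
def cubeChar {n : ℕ} (S : Finset (Fin n)) (z : Fin n → ℤˣ) : ℝ := ∏ i ∈ S, ((z i : ℤ) : ℝ)

theorem cubeChar_mul {n : ℕ} (S : Finset (Fin n)) (x y : Fin n → ℤˣ) :
    cubeChar S (x * y) = cubeChar S x * cubeChar S y := by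
  simp [cubeChar, Finset.prod_mul_distrib]

theorem sum_cubeChar {n : ℕ} (x : Fin n → ℤˣ) :
    ∑ S, cubeChar S x = if x = 1 then 2 ^ n else 0 := by
  simp only [cubeChar]
  rw [← Finset.powerset_univ, ← Finset.prod_one_add]
  split_ifs with h
  · simp [h, one_add_one_eq_two]
  · obtain ⟨i, hi⟩ : ∃ i, x i ≠ 1 := by
      by_contra! hc
      exact h (funext hc)
    apply Finset.prod_eq_zero (Finset.mem_univ i)
    rw [(Int.units_eq_one_or (x i)).resolve_left hi]
    simp

theorem mul_mul_eq_one_iff_cube {n : ℕ} (x y z : Fin n → ℤˣ) :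
    z * (x * y) = 1 ↔ y = x * z := by
  have hx : x * x = 1 := funext fun i => by simp
  have hz : z * z = 1 := funext fun i => by simp
  constructor
  · intro h
    calc y = (x * x) * (z * z) * y := by rw [hx, hz]; simp
      _ = x * z * (z * (x * y)) := by ac_rfl
      _ = x * z := by rw [h, mul_one]
  · rintro rfl
    calc z * (x * (x * z)) = (x * x) * (z * z) := by ac_rfl
      _ = 1 := by rw [hx, hz, mul_one]

/-- Diagonalization of convolution forms by characters. -/
theorem sum_fourier_kernel {n : ℕ} (c f : (Fin n → ℤˣ) → ℝ) :
    ∑ S, (∑ z, c z * cubeChar S z) * (∑ x, f x * cubeChar S x) ^ 2 =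
      2 ^ n * ∑ x, ∑ z, c z * (f x * f (x * z)) := by
  have h1 : ∀ S, (∑ z, c z * cubeChar S z) * (∑ x, f x * cubeChar S x) ^ 2 =
      ∑ x, ∑ z, ∑ y, c z * (f x * f y) * cubeChar S (z * (x * y)) := by
    intro S
    rw [sq, Finset.sum_mul_sum, Finset.sum_mul_sum, Finset.sum_comm]
    refine Finset.sum_congr rfl fun x _ => Finset.sum_congr rfl fun z _ => ?_
    rw [Finset.mul_sum]
    refine Finset.sum_congr rfl fun y _ => ?_
    rw [cubeChar_mul, cubeChar_mul]
    ring
  rw [Finset.sum_congr rfl fun S _ => h1 S, Finset.sum_comm, Finset.mul_sum]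
  refine Finset.sum_congr rfl fun x _ => ?_
  rw [Finset.sum_comm, Finset.mul_sum]
  refine Finset.sum_congr rfl fun z _ => ?_
  rw [Finset.sum_comm]
  simp only [← Finset.mul_sum, sum_cubeChar, mul_mul_eq_one_iff_cube, mul_ite, mul_zero,
    Finset.sum_ite_eq', Finset.mem_univ, if_true]
  ring

/-- A convolution form is bounded by the largest Fourier coefficient of its kernel. -/
theorem sum_kernel_le {n : ℕ} {c : (Fin n → ℤˣ) → ℝ} {ε : ℝ}
    (hc : ∀ S, ∑ z, c z * cubeChar S z ≤ ε) (f : (Fin n → ℤˣ) → ℝ) :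
    ∑ x, ∑ z, c z * (f x * f (x * z)) ≤ ε * ∑ x, f x ^ 2 := by
  have hδ := sum_fourier_kernel (fun z : Fin n → ℤˣ => if z = 1 then (1 : ℝ) else 0) f
  have hcf := sum_fourier_kernel c f
  simp only [ite_mul, one_mul, zero_mul, Finset.sum_ite_eq', Finset.mem_univ, if_true,
    mul_one] at hδ
  have h1 : ∀ S : Finset (Fin n), cubeChar S (1 : Fin n → ℤˣ) = 1 := fun S => by simp [cubeChar]
  simp only [h1, one_mul, ← sq] at hδ
  have hle : ∑ S, (∑ z, c z * cubeChar S z) * (∑ x, f x * cubeChar S x) ^ 2 ≤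
      ε * ∑ S, (∑ x, f x * cubeChar S x) ^ 2 := by
    rw [Finset.mul_sum]
    exact Finset.sum_le_sum fun S _ => mul_le_mul_of_nonneg_right (hc S) (sq_nonneg _)
  rw [hcf, hδ] at hle
  have h2 : (0 : ℝ) < 2 ^ n := by positivity
  nlinarith

/-- The Krawtchouk number: the coefficient of `X ^ r` in `(1 - X) ^ k * (1 + X) ^ (n - k)`. -/
def krawt (n r k : ℕ) : ℝ :=
  ((1 - Polynomial.X) ^ k * (1 + Polynomial.X) ^ (n - k) : Polynomial ℝ).coeff r

theorem sum_cube_prod {R : Type*} [CommSemiring R] {n : ℕ} (h : Fin n → ℤˣ → R) :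
    ∑ z : Fin n → ℤˣ, ∏ i, h i (z i) = ∏ i, (h i 1 + h i (-1)) := by
  rw [← Fintype.piFinset_univ, ← Finset.prod_univ_sum]
  refine Finset.prod_congr rfl fun i _ => ?_
  rw [UnitsInt.univ, Finset.sum_pair (by decide)]

theorem prod_ite_mem_const {R : Type*} [CommSemiring R] {n : ℕ} (S : Finset (Fin n)) (a b : R) :
    ∏ i, (if i ∈ S then a else b) = a ^ S.card * b ^ (n - S.card) := by
  rw [Finset.prod_ite, Finset.prod_const, Finset.prod_const]
  congr 2
  · simp
  · rw [Finset.filter_not]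
    simp [Finset.card_sdiff]

theorem cubeChar_eq_prod_univ {n : ℕ} (S : Finset (Fin n)) (z : Fin n → ℤˣ) :
    cubeChar S z = ∏ i, if i ∈ S then ((z i : ℤ) : ℝ) else 1 := by
  simp [cubeChar]

theorem sum_noise_cubeChar {n : ℕ} (β : ℝ) (S : Finset (Fin n)) :
    ∑ z : Fin n → ℤˣ, (∏ i, if z i = 1 then 1 - β else β) * cubeChar S z =
      (1 - 2 * β) ^ S.card := by
  simp only [cubeChar_eq_prod_univ, ← Finset.prod_mul_distrib]
  rw [sum_cube_prod fun i u => (if u = 1 then 1 - β else β) *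
    if i ∈ S then ((u : ℤ) : ℝ) else 1]
  calc _ = ∏ i, (if i ∈ S then 1 - 2 * β else 1) := by
        refine Finset.prod_congr rfl fun i _ => ?_
        simp only [if_true, show (-1 : ℤˣ) ≠ 1 by decide, if_false]
        split_ifs <;> simp
        ring
    _ = _ := by rw [prod_ite_mem_const, one_pow, mul_one]

theorem cubeChar_univ_mul {n : ℕ} (S : Finset (Fin n)) (z : Fin n → ℤˣ) :
    cubeChar Finset.univ z * cubeChar S z = cubeChar Sᶜ z := by
  simp only [cubeChar_eq_prod_univ, ← Finset.prod_mul_distrib]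
  refine Finset.prod_congr rfl fun i _ => ?_
  by_cases hi : i ∈ S <;> rcases Int.units_eq_one_or (z i) with h | h <;> simp [hi, h]

theorem sum_noise_cubeChar_univ {n : ℕ} (β : ℝ) (S : Finset (Fin n)) :
    ∑ z : Fin n → ℤˣ, (∏ i, if z i = 1 then 1 - β else β) * cubeChar Finset.univ z *
      cubeChar S z = (1 - 2 * β) ^ (n - S.card) := by
  simp only [mul_assoc, cubeChar_univ_mul]
  rw [sum_noise_cubeChar, Finset.card_compl, Fintype.card_fin]

open Polynomial in
theorem sum_cubeChar_X_pow {n : ℕ} (S : Finset (Fin n)) :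
    ∑ z : Fin n → ℤˣ, C (cubeChar S z) * X ^ hammingDist z 1 =
      ((1 - X) ^ S.card * (1 + X) ^ (n - S.card) : ℝ[X]) := by
  have hX : ∀ z : Fin n → ℤˣ, (X : ℝ[X]) ^ hammingDist z 1 =
      ∏ i, if z i = 1 then 1 else X := by
    intro z
    rw [Finset.prod_ite, Finset.prod_const_one, one_mul, Finset.prod_const]
    rfl
  simp only [hX, cubeChar_eq_prod_univ, map_prod, ← Finset.prod_mul_distrib]
  rw [sum_cube_prod fun i u => C (if i ∈ S then ((u : ℤ) : ℝ) else 1) *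
    (if u = 1 then (1 : ℝ[X]) else X), ← prod_ite_mem_const]
  refine Finset.prod_congr rfl fun i _ => ?_
  simp only [if_true, show (-1 : ℤˣ) ≠ 1 by decide, if_false]
  split_ifs <;> simp
  ring

theorem sum_hSphere_cubeChar {n : ℕ} (r : ℕ) (S : Finset (Fin n)) :
    ∑ z ∈ hSphere n r, cubeChar S z = krawt n r S.card := by
  rw [krawt, ← sum_cubeChar_X_pow, Polynomial.finsetSum_coeff, hSphere, Finset.sum_filter]
  refine Finset.sum_congr rfl fun z _ => ?_
  simp [Polynomial.coeff_X_pow, eq_comm]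

theorem sum_hBall {n : ℕ} (r : ℕ) (f : (Fin n → ℤˣ) → ℝ) :
    ∑ z ∈ hBall n r, f z = ∑ i ∈ Finset.range (r + 1), ∑ z ∈ hSphere n i, f z := by
  simp only [hBall, hSphere, Finset.sum_filter]
  rw [Finset.sum_comm]
  refine Finset.sum_congr rfl fun z _ => ?_
  simp

theorem krawt_zero (n r : ℕ) : krawt n r 0 = n.choose r := by
  simp [krawt, Polynomial.coeff_one_add_X_pow]

theorem card_hSphere (n r : ℕ) : ((hSphere n r).card : ℝ) = n.choose r := by
  have h := sum_hSphere_cubeChar r (∅ : Finset (Fin n))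
  simpa [cubeChar, krawt_zero] using h

theorem card_hBall (n r : ℕ) :
    ((hBall n r).card : ℝ) = ∑ i ∈ Finset.range (r + 1), (n.choose i : ℝ) := by
  have h := sum_hBall (n := n) r (fun _ => (1 : ℝ))
  simpa [card_hSphere] using h

theorem sum_coeff_one_sub_X_mul (Q : Polynomial ℝ) (r : ℕ) :
    ∑ i ∈ Finset.range (r + 1), ((1 - Polynomial.X) * Q).coeff i = Q.coeff r := by
  induction r with
  | zero => simp
  | succ r ih =>
    rw [Finset.sum_range_succ, ih, sub_mul, one_mul, Polynomial.coeff_sub,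
      Polynomial.coeff_X_mul]
    ring

theorem sum_hBall_cubeChar {n : ℕ} (r : ℕ) (S : Finset (Fin n)) (hS : S.card ≠ 0) :
    ∑ z ∈ hBall n r, cubeChar S z = krawt (n - 1) r (S.card - 1) := by
  rw [sum_hBall, krawt, ← sum_coeff_one_sub_X_mul]
  refine Finset.sum_congr rfl fun i _ => ?_
  rw [sum_hSphere_cubeChar, krawt, ← mul_assoc, ← pow_succ',
    show S.card - 1 + 1 = S.card by omega, show n - 1 - (S.card - 1) = n - S.card by omega]

/-- Reflection of Krawtchouk numbers. -/
theorem krawt_reflect {n k : ℕ} (r : ℕ) (hk : k ≤ n) :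
    krawt n r k = (-1) ^ r * krawt n r (n - k) := by
  have hc : ∀ P : Polynomial ℝ, (P.comp (-Polynomial.X)).coeff r = (-1) ^ r * P.coeff r := by
    intro P
    have := Polynomial.comp_C_mul_X_coeff (p := P) (r := (-1 : ℝ)) (n := r)
    simpa [mul_comm] using this
  rw [krawt, krawt, ← hc]
  simp [Nat.sub_sub_self hk, ← sub_eq_add_neg, mul_comm]

theorem abs_coeff_mul_le {P P' Q Q' : Polynomial ℝ} (h : ∀ i, |P.coeff i| ≤ P'.coeff i)
    (h' : ∀ i, |Q.coeff i| ≤ Q'.coeff i) (i : ℕ) : |(P * Q).coeff i| ≤ (P' * Q').coeff i := by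
  rw [Polynomial.coeff_mul, Polynomial.coeff_mul]
  refine (Finset.abs_sum_le_sum_abs _ _).trans (Finset.sum_le_sum fun x _ => ?_)
  rw [abs_mul]
  exact mul_le_mul (h _) (h' _) (abs_nonneg _) ((abs_nonneg _).trans (h _))

theorem abs_coeff_pow_le {P P' : Polynomial ℝ} (h : ∀ i, |P.coeff i| ≤ P'.coeff i) (m i : ℕ) :
    |(P ^ m).coeff i| ≤ (P' ^ m).coeff i := by
  induction m generalizing i with
  | zero =>
    simp only [pow_zero, Polynomial.coeff_one]
    split_ifs <;> simp
  | succ m ih =>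
    rw [pow_succ, pow_succ]
    exact abs_coeff_mul_le ih h i

open Polynomial in
/-- Pairing `m` coordinates inside the first block with `m` outside it dominates the
Krawtchouk number. -/
theorem abs_krawt_le {n k m : ℕ} (r : ℕ) (hm : m ≤ k) (hk : 2 * k ≤ n) :
    |krawt n r k| ≤ ((1 + X ^ 2) ^ m * (1 + X) ^ (n - 2 * m) : ℝ[X]).coeff r := by
  have hfac : ((1 - X) ^ k * (1 + X) ^ (n - k) : ℝ[X]) =
      (1 - X ^ 2) ^ m * ((1 - X) ^ (k - m) * (1 + X) ^ (n - k - m)) := by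
    rw [show (1 - X ^ 2 : ℝ[X]) = (1 - X) * (1 + X) by ring, mul_pow]
    nth_rewrite 1 [show k = m + (k - m) by omega]
    rw [pow_add]
    nth_rewrite 1 [show n - k = m + (n - k - m) by omega]
    rw [pow_add]
    ring
  have hplus : ((1 + X) ^ (n - 2 * m) : ℝ[X]) = (1 + X) ^ (k - m) * (1 + X) ^ (n - k - m) := by
    rw [← pow_add]
    congr 1
    omega
  rw [krawt, hfac, hplus]
  have h1 : ∀ i, |(1 - X ^ 2 : ℝ[X]).coeff i| ≤ (1 + X ^ 2 : ℝ[X]).coeff i := by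
    intro i
    simp only [coeff_sub, coeff_add, coeff_one, coeff_X_pow]
    split_ifs <;> norm_num
  have h2 : ∀ i, |(1 - X : ℝ[X]).coeff i| ≤ (1 + X : ℝ[X]).coeff i := by
    intro i
    simp only [coeff_sub, coeff_add, coeff_one, coeff_X]
    split_ifs <;> norm_num
  have h3 : ∀ i, |(1 + X : ℝ[X]).coeff i| ≤ (1 + X : ℝ[X]).coeff i := by
    intro i
    simp only [coeff_add, coeff_one, coeff_X]
    split_ifs <;> norm_num
  exact abs_coeff_mul_le (abs_coeff_pow_le h1 m)
    (abs_coeff_mul_le (abs_coeff_pow_le h2 _) (abs_coeff_pow_le h3 _)) r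

open Filter

open scoped Topology

section Asymptotics

variable {N r : ℕ → ℕ} {β : ℝ}

theorem tendsto_const_div_natCast (hN : Tendsto N atTop atTop) (c : ℝ) :
    Tendsto (fun n => c / (N n : ℝ)) atTop (𝓝 0) :=
  (tendsto_natCast_atTop_atTop.comp hN).const_div_atTop c

theorem eventually_le_of_ratio (hβ0 : 0 < β) (hN : Tendsto N atTop atTop)
    (hr : Tendsto (fun n => (r n : ℝ) / N n) atTop (𝓝 β)) (j : ℕ) :
    ∀ᶠ n in atTop, j ≤ r n := by
  have h := hr.sub (tendsto_const_div_natCast hN j)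
  rw [sub_zero] at h
  filter_upwards [h.eventually (lt_mem_nhds hβ0), hN.eventually_gt_atTop 0] with n hn hNn
  have hNn' : (0 : ℝ) < N n := by exact_mod_cast hNn
  rw [← sub_div, lt_div_iff₀ hNn', zero_mul] at hn
  have : (j : ℝ) < r n := by linarith
  exact_mod_cast this.le

theorem eventually_add_le_of_ratio (hβ1 : β < 1) (hN : Tendsto N atTop atTop)
    (hr : Tendsto (fun n => (r n : ℝ) / N n) atTop (𝓝 β)) (j : ℕ) :
    ∀ᶠ n in atTop, r n + j ≤ N n := by
  have h := hr.add (tendsto_const_div_natCast hN j)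
  rw [add_zero] at h
  filter_upwards [h.eventually (gt_mem_nhds hβ1), hN.eventually_gt_atTop 0] with n hn hNn
  have hNn' : (0 : ℝ) < N n := by exact_mod_cast hNn
  rw [← add_div, div_lt_iff₀ hNn', one_mul] at hn
  exact_mod_cast hn.le

theorem tendsto_ratio_pred (hN : Tendsto N atTop atTop)
    (hr : Tendsto (fun n => (r n : ℝ) / N n) atTop (𝓝 β)) :
    Tendsto (fun n => (r n : ℝ) / (N n - 1 : ℕ)) atTop (𝓝 β) := by
  have h := hr.div ((tendsto_const_nhds (x := (1 : ℝ))).sub (tendsto_const_div_natCast hN 1))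
    (by norm_num)
  rw [sub_zero, div_one] at h
  refine h.congr' ?_
  filter_upwards [hN.eventually_gt_atTop 1] with n hn
  have h1 : (1 : ℝ) < N n := by exact_mod_cast hn
  have h0 : (N n : ℝ) ≠ 0 := by linarith
  have h2 : (N n : ℝ) - 1 ≠ 0 := by linarith
  simp only [Pi.div_apply]
  rw [Nat.cast_sub hn.le, Nat.cast_one]
  field_simp

theorem tendsto_choose_sub_div (hβ0 : 0 < β) (hβ1 : β < 1) (hN : Tendsto N atTop atTop)
    (hr : Tendsto (fun n => (r n : ℝ) / N n) atTop (𝓝 β)) (j : ℕ) :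
    Tendsto (fun n => ((N n).choose (r n - j) : ℝ) / (N n).choose (r n)) atTop
      (𝓝 ((β / (1 - β)) ^ j)) := by
  induction j with
  | zero =>
    refine Tendsto.congr' ?_ tendsto_const_nhds
    filter_upwards [eventually_add_le_of_ratio hβ1 hN hr 0] with n hn
    have : ((N n).choose (r n) : ℝ) ≠ 0 := by
      exact_mod_cast (Nat.choose_pos (by omega)).ne'
    simp [this]
  | succ j ih =>
    have hstep : Tendsto (fun n => ((r n : ℝ) / N n - j / N n) /
        (1 - (r n : ℝ) / N n + (j + 1) / N n)) atTop (𝓝 (β / (1 - β))) := by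
      have h := (hr.sub (tendsto_const_div_natCast hN j)).div
        ((tendsto_const_nhds.sub hr).add (tendsto_const_div_natCast hN (j + 1)))
        (by linarith : 1 - β + 0 ≠ 0)
      rw [sub_zero, add_zero] at h
      exact h
    rw [pow_succ]
    refine (ih.mul hstep).congr' ?_
    filter_upwards [eventually_add_le_of_ratio hβ1 hN hr 0,
      eventually_le_of_ratio hβ0 hN hr (j + 1), hN.eventually_gt_atTop 0] with n hn hj hNn
    have hc := Nat.choose_succ_right_eq (N n) (r n - (j + 1))
    rw [show r n - (j + 1) + 1 = r n - j by omega] at hc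
    have hc' : ((N n).choose (r n - j) : ℝ) * (r n - j) =
        (N n).choose (r n - (j + 1)) * (N n - r n + (j + 1)) := by
      have := congrArg (Nat.cast (R := ℝ)) hc
      rw [Nat.cast_mul, Nat.cast_mul, Nat.cast_sub (by omega), Nat.cast_sub (by omega),
        Nat.cast_sub (by omega)] at this
      rw [this]
      push_cast
      ring
    have h0 : (0 : ℝ) < N n := by exact_mod_cast hNn
    have h1 : (r n : ℝ) ≤ N n := by exact_mod_cast hn
    have h2 : (0 : ℝ) < N n - r n + (j + 1) := by
      have : (0 : ℝ) ≤ j := by positivity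
      linarith
    rw [show ((r n : ℝ) / N n - j / N n) / (1 - (r n : ℝ) / N n + (j + 1) / N n) =
      (r n - j) / (N n - r n + (j + 1)) by
        rw [← sub_div, show (1 : ℝ) - (r n : ℝ) / N n + (j + 1) / N n =
          (N n - r n + (j + 1)) / N n by field_simp]
        field_simp]
    rw [div_mul_div_comm, hc', mul_comm (((N n).choose (r n) : ℝ)), mul_comm,
      mul_div_mul_left _ _ h2.ne']

theorem choose_pred_div {n r : ℕ} (h : r < n) :
    ((n - 1).choose r : ℝ) / n.choose r = 1 - r / n := by
  obtain ⟨m, rfl⟩ : ∃ m, n = m + 1 := ⟨n - 1, by omega⟩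
  have hc := congrArg (Nat.cast (R := ℝ)) (Nat.choose_mul_succ_eq m r)
  rw [Nat.cast_mul, Nat.cast_mul, Nat.cast_sub h.le] at hc
  have h0 : ((m + 1).choose r : ℝ) ≠ 0 := by exact_mod_cast (Nat.choose_pos h.le).ne'
  have h1 : ((m + 1 : ℕ) : ℝ) ≠ 0 := by positivity
  rw [Nat.add_sub_cancel]
  field_simp
  linarith

theorem tendsto_choose_pred_div (hβ1 : β < 1) (hN : Tendsto N atTop atTop)
    (hr : Tendsto (fun n => (r n : ℝ) / N n) atTop (𝓝 β)) :
    Tendsto (fun n => ((N n - 1).choose (r n) : ℝ) / (N n).choose (r n)) atTop (𝓝 (1 - β)) := by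
  refine (tendsto_const_nhds.sub hr).congr' ?_
  filter_upwards [eventually_add_le_of_ratio hβ1 hN hr 1] with n hn
  rw [choose_pred_div (by omega)]

theorem tendsto_choose_sub_left_div (hβ1 : β < 1) (hN : Tendsto N atTop atTop)
    (hr : Tendsto (fun n => (r n : ℝ) / N n) atTop (𝓝 β)) (m : ℕ) :
    Tendsto (fun n => ((N n - m).choose (r n) : ℝ) / (N n).choose (r n)) atTop
      (𝓝 ((1 - β) ^ m)) := by
  induction m generalizing N with
  | zero =>
    refine Tendsto.congr' ?_ tendsto_const_nhds
    filter_upwards [eventually_add_le_of_ratio hβ1 hN hr 0] with n hn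
    have : ((N n).choose (r n) : ℝ) ≠ 0 := by
      exact_mod_cast (Nat.choose_pos (by omega)).ne'
    simp [this]
  | succ m ih =>
    have h1 := ih ((tendsto_sub_atTop_nat 1).comp hN) (tendsto_ratio_pred hN hr)
    rw [pow_succ]
    refine (h1.mul (tendsto_choose_pred_div hβ1 hN hr)).congr' ?_
    filter_upwards [eventually_add_le_of_ratio hβ1 hN hr 1] with n hn
    have : ((N n - 1).choose (r n) : ℝ) ≠ 0 := by
      exact_mod_cast (Nat.choose_pos (by omega)).ne'
    simp only [Function.comp_apply]
    rw [div_mul_div_cancel₀ this, Nat.sub_sub, add_comm 1 m]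

theorem tendsto_sub_const_ratio (hN : Tendsto N atTop atTop)
    (hr : Tendsto (fun n => (r n : ℝ) / N n) atTop (𝓝 β)) (m : ℕ) :
    Tendsto (fun n => (r n : ℝ) / (N n - m : ℕ)) atTop (𝓝 β) := by
  induction m with
  | zero => simpa using hr
  | succ m ih =>
    exact (tendsto_ratio_pred ((tendsto_sub_atTop_nat m).comp hN) ih).congr fun n => by
      rw [Function.comp_apply, Nat.sub_sub]

open Polynomial in
/-- Coefficients of a fixed polynomial times a large power of `1 + X`. -/
theorem tendsto_coeff_mul_one_add_X_pow (hβ0 : 0 < β) (hβ1 : β < 1) (hN : Tendsto N atTop atTop)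
    (hr : Tendsto (fun n => (r n : ℝ) / N n) atTop (𝓝 β)) (m : ℕ) (P : ℝ[X]) :
    Tendsto (fun n => (P * (1 + X) ^ (N n - m)).coeff (r n) / ((N n).choose (r n) : ℝ)) atTop
      (𝓝 ((1 - β) ^ m * P.eval (β / (1 - β)))) := by
  induction P using Polynomial.induction_on' with
  | add P Q hP hQ =>
    simp only [add_mul, coeff_add, add_div, eval_add, mul_add]
    exact hP.add hQ
  | monomial j a =>
    have hNm : Tendsto (fun n => N n - m) atTop atTop := (tendsto_sub_atTop_nat m).comp hN
    have hrm := tendsto_sub_const_ratio hN hr m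
    have h := ((tendsto_choose_sub_div hβ0 hβ1 hNm hrm j).mul
      (tendsto_choose_sub_left_div hβ1 hN hr m)).const_mul a
    rw [eval_monomial, show (1 - β) ^ m * (a * (β / (1 - β)) ^ j) =
      a * ((β / (1 - β)) ^ j * (1 - β) ^ m) by ring]
    refine h.congr' ?_
    filter_upwards [eventually_add_le_of_ratio hβ1 hNm hrm 0, eventually_le_of_ratio hβ0 hN hr j]
      with n hn hj
    have : ((N n - m).choose (r n) : ℝ) ≠ 0 := by
      exact_mod_cast (Nat.choose_pos (by omega)).ne'
    rw [div_mul_div_cancel₀ this, ← C_mul_X_pow_eq_monomial, mul_assoc, coeff_C_mul,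
      coeff_X_pow_mul', if_pos hj, coeff_one_add_X_pow, mul_div_assoc]

/-- Normalized Krawtchouk numbers of the lower half are uniformly close to powers of `1 - 2β`. -/
theorem eventually_abs_krawt_sub_le (hβ0 : 0 < β) (hβ : β ≤ 1 / 2) (hN : Tendsto N atTop atTop)
    (hr : Tendsto (fun n => (r n : ℝ) / N n) atTop (𝓝 β)) {ε : ℝ} (hε : 0 < ε) :
    ∀ᶠ n in atTop, ∀ k, 2 * k ≤ N n →
      |krawt (N n) (r n) k / (N n).choose (r n) - (1 - 2 * β) ^ k| ≤ ε := by
  have hβ1 : β < 1 := by linarith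
  have hβ' : 1 - β ≠ 0 := by linarith
  have hsmall : ∀ t : ℝ, 0 ≤ t → t < 1 → ∀ᶠ m : ℕ in atTop, t ^ m < ε / 2 := fun t h0 h1 =>
    (tendsto_pow_atTop_nhds_zero_of_lt_one h0 h1).eventually (gt_mem_nhds (by linarith))
  obtain ⟨m, hm1, hm2⟩ := ((hsmall (1 - 2 * β) (by linarith) (by linarith)).and
    (hsmall ((1 - β) ^ 2 + β ^ 2) (by positivity) (by nlinarith))).exists
  have hlow : ∀ᶠ n in atTop, ∀ k ∈ Finset.range m,
      |krawt (N n) (r n) k / (N n).choose (r n) - (1 - 2 * β) ^ k| ≤ ε := by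
    rw [Filter.eventually_all_finset]
    intro k _
    have h := tendsto_coeff_mul_one_add_X_pow hβ0 hβ1 hN hr k ((1 - Polynomial.X) ^ k)
    have hval : (1 - β) ^ k * ((1 - Polynomial.X : Polynomial ℝ) ^ k).eval (β / (1 - β)) =
        (1 - 2 * β) ^ k := by
      simp only [Polynomial.eval_pow, Polynomial.eval_sub, Polynomial.eval_one, Polynomial.eval_X]
      rw [← mul_pow]
      congr 1
      field_simp
      ring
    rw [hval] at h
    filter_upwards [h.eventually (Metric.closedBall_mem_nhds _ hε)] with n hn
    simpa [Real.dist_eq, krawt] using hn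
  have hhigh : ∀ᶠ n in atTop, ((1 + Polynomial.X ^ 2) ^ m * (1 + Polynomial.X) ^ (N n - 2 * m) :
      Polynomial ℝ).coeff (r n) / ((N n).choose (r n) : ℝ) < ε / 2 := by
    have h := tendsto_coeff_mul_one_add_X_pow hβ0 hβ1 hN hr (2 * m) ((1 + Polynomial.X ^ 2) ^ m)
    refine h.eventually (gt_mem_nhds ?_)
    simp only [Polynomial.eval_pow, Polynomial.eval_add, Polynomial.eval_one, Polynomial.eval_X]
    rw [pow_mul, ← mul_pow]
    rwa [show (1 - β) ^ 2 * (1 + (β / (1 - β)) ^ 2) = (1 - β) ^ 2 + β ^ 2 by field_simp]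
  filter_upwards [hlow, hhigh] with n h1 h2 k hk
  by_cases hkm : k < m
  · exact h1 k (Finset.mem_range.2 hkm)
  · have hb := div_le_div_of_nonneg_right (abs_krawt_le (r n) (not_lt.1 hkm) hk)
      (Nat.cast_nonneg ((N n).choose (r n)) : (0 : ℝ) ≤ _)
    have hpow : (1 - 2 * β) ^ k ≤ (1 - 2 * β) ^ m :=
      pow_le_pow_of_le_one (by linarith) (by linarith) (not_lt.1 hkm)
    have hpow0 : 0 ≤ (1 - 2 * β) ^ k := pow_nonneg (by linarith) k
    refine (abs_sub _ _).trans ?_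
    rw [abs_div, Nat.abs_cast, abs_of_nonneg hpow0]
    linarith

theorem exists_div_geom_sum_le (hβ0 : 0 < β) (hβ : β ≤ 1 / 2) {ε : ℝ} (hε : 0 < ε) :
    ∃ m : ℕ, 0 < m ∧
      (1 - β) / ∑ i ∈ Finset.range m, (β / (1 - β)) ^ i ≤ 1 - 2 * β + ε := by
  obtain ⟨m, hm⟩ := exists_nat_gt (1 / ε)
  have hm0 : (0 : ℝ) < m := lt_trans (by positivity) hm
  have hb : 0 < 1 - β := by linarith
  set q := β / (1 - β) with hq
  have hq0 : 0 < q := by positivity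
  have hq1 : q ≤ 1 := by rw [hq, div_le_one hb]; linarith
  refine ⟨m, by exact_mod_cast hm0, ?_⟩
  have hsum : m * q ^ m ≤ ∑ i ∈ Finset.range m, q ^ i := by
    calc (m : ℝ) * q ^ m = ∑ i ∈ Finset.range m, q ^ m := by simp
      _ ≤ _ := Finset.sum_le_sum fun i hi =>
        pow_le_pow_of_le_one hq0.le hq1 (Finset.mem_range.1 hi).le
  have hpos : 0 < ∑ i ∈ Finset.range m, q ^ i := lt_of_lt_of_le (by positivity) hsum
  rw [div_le_iff₀ hpos]
  have hgeom := geom_sum_mul_neg q m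
  have hρ : (1 - 2 * β) = (1 - β) * (1 - q) := by rw [hq]; field_simp; ring
  have hεm : 1 ≤ ε * m := by
    rw [div_lt_iff₀ hε] at hm
    linarith
  have hqm : 0 < q ^ m := by positivity
  have h1 : q ^ m ≤ ε * ∑ i ∈ Finset.range m, q ^ i := by nlinarith
  rw [hρ]
  nlinarith

theorem eventually_choose_div_ball_le (hβ0 : 0 < β) (hβ : β ≤ 1 / 2)
    (hN : Tendsto N atTop atTop) (hr : Tendsto (fun n => (r n : ℝ) / N n) atTop (𝓝 β))
    {ε : ℝ} (hε : 0 < ε) :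
    ∀ᶠ n in atTop, ((N n - 1).choose (r n) : ℝ) /
      ∑ i ∈ Finset.range (r n + 1), ((N n).choose i : ℝ) ≤ 1 - 2 * β + ε := by
  have hβ1 : β < 1 := by linarith
  obtain ⟨m, hm, hle⟩ := exists_div_geom_sum_le hβ0 hβ (half_pos hε)
  have hq0 : 0 < β / (1 - β) := div_pos hβ0 (by linarith)
  have hpos : 0 < ∑ i ∈ Finset.range m, (β / (1 - β)) ^ i :=
    Finset.sum_pos (fun i _ => by positivity) ⟨0, Finset.mem_range.2 hm⟩
  have hlim := (tendsto_choose_pred_div hβ1 hN hr).div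
    (tendsto_finsetSum (Finset.range m) fun i _ => tendsto_choose_sub_div hβ0 hβ1 hN hr i)
    hpos.ne'
  filter_upwards [hlim.eventually (gt_mem_nhds (hle.trans_lt (by linarith :
      1 - 2 * β + ε / 2 < 1 - 2 * β + ε))), eventually_add_le_of_ratio hβ1 hN hr 0,
    eventually_le_of_ratio hβ0 hN hr m] with n hn hrN hmr
  have hc : (0 : ℝ) < (N n).choose (r n) := by exact_mod_cast Nat.choose_pos (by omega)
  simp only [Pi.div_apply] at hn
  rw [← Finset.sum_div, div_div_div_cancel_right₀ hc.ne'] at hn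
  refine le_trans ?_ hn.le
  have hsub : ∑ i ∈ Finset.range m, ((N n).choose (r n - i) : ℝ) ≤
      ∑ i ∈ Finset.range (r n + 1), ((N n).choose i : ℝ) := by
    rw [← Finset.sum_range_reflect (fun i => ((N n).choose i : ℝ)) (r n + 1)]
    simp only [Nat.add_sub_cancel]
    exact Finset.sum_le_sum_of_subset_of_nonneg (by simp; omega) fun _ _ _ => by positivity
  have hpos' : 0 < ∑ i ∈ Finset.range m, ((N n).choose (r n - i) : ℝ) :=
    Finset.sum_pos (fun i _ => by exact_mod_cast Nat.choose_pos (by omega))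
      ⟨0, Finset.mem_range.2 hm⟩
  exact div_le_div_of_nonneg_left (by positivity) hpos' hsub

end Asymptotics

theorem eventually_sphere_eigenvalue_le {r : ℕ → ℕ} {β t : ℝ} (hβ0 : 0 < β) (hβ : β ≤ 1 / 2)
    (ht0 : 0 ≤ t) (hr : Tendsto (fun n => (r n : ℝ) / n) atTop (𝓝 β))
    (ht : ∀ n, Even (r n) → 1 ≤ t) {ε : ℝ} (hε : 0 < ε) :
    ∀ᶠ n in atTop, ∀ S : Finset (Fin n),
      (∑ z ∈ hSphere n (r n), cubeChar S z) / (hSphere n (r n)).card ≤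
        (1 - 2 * β) ^ S.card + t * (1 - 2 * β) ^ (n - S.card) + ε := by
  have hρ : 0 ≤ 1 - 2 * β := by linarith
  filter_upwards [eventually_abs_krawt_sub_le hβ0 hβ tendsto_id hr hε] with n hn S
  simp only [id] at hn
  have hS : S.card ≤ n := by simpa using S.card_le_univ
  rw [sum_hSphere_cubeChar, card_hSphere]
  have hp : 0 ≤ (1 - 2 * β) ^ S.card := pow_nonneg hρ _
  have hp' : 0 ≤ (1 - 2 * β) ^ (n - S.card) := pow_nonneg hρ _
  by_cases hk : 2 * S.card ≤ n
  · have h := (abs_le.1 (hn _ hk)).2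
    have := mul_nonneg ht0 hp'
    linarith
  · have h := abs_le.1 (hn (n - S.card) (by omega))
    rw [krawt_reflect _ hS]
    rcases Nat.even_or_odd (r n) with he | ho
    · rw [he.neg_one_pow, one_mul]
      nlinarith [ht n he]
    · rw [ho.neg_one_pow, neg_one_mul, neg_div]
      have := mul_nonneg ht0 hp'
      linarith

theorem eventually_ball_eigenvalue_le {r : ℕ → ℕ} {β t : ℝ} (hβ0 : 0 < β) (hβ : β ≤ 1 / 2)
    (ht0 : 0 ≤ t) (hr : Tendsto (fun n => (r n : ℝ) / n) atTop (𝓝 β))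
    (ht : ∀ n, Even (r n) → 1 - 2 * β ≤ t) {ε : ℝ} (hε : 0 < ε) :
    ∀ᶠ n in atTop, ∀ S : Finset (Fin n),
      (∑ z ∈ hBall n (r n), cubeChar S z) / (hBall n (r n)).card ≤
        (1 - 2 * β) ^ S.card + t * (1 - 2 * β) ^ (n - S.card) + ε := by
  have hρ : 0 ≤ 1 - 2 * β := by linarith
  filter_upwards [eventually_abs_krawt_sub_le hβ0 hβ (tendsto_sub_atTop_nat 1)
      (tendsto_ratio_pred tendsto_id hr) (half_pos hε),
    eventually_choose_div_ball_le hβ0 hβ tendsto_id hr (half_pos hε),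
    eventually_add_le_of_ratio (by linarith) tendsto_id hr 1] with n hn hτ hrn S
  simp only [id] at hτ hrn
  have hS : S.card ≤ n := by simpa using S.card_le_univ
  have hp : 0 ≤ (1 - 2 * β) ^ S.card := pow_nonneg hρ _
  have hp' : 0 ≤ (1 - 2 * β) ^ (n - S.card) := pow_nonneg hρ _
  have htp := mul_nonneg ht0 hp'
  rcases Nat.eq_zero_or_pos S.card with h0 | hpos
  · have : ∀ z : Fin n → ℤˣ, cubeChar S z = 1 := by
      rw [Finset.card_eq_zero.1 h0]
      simp [cubeChar]
    simp only [this, Finset.sum_const, nsmul_eq_mul, mul_one]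
    have h1 := div_self_le_one ((hBall n (r n)).card : ℝ)
    rw [show (1 - 2 * β) ^ S.card = 1 by rw [h0, pow_zero]]
    linarith
  rw [sum_hBall_cubeChar _ _ hpos.ne', card_hBall]
  have hc : (0 : ℝ) < (n - 1).choose (r n) := by exact_mod_cast Nat.choose_pos (by omega)
  have hball : ((n - 1).choose (r n) : ℝ) ≤ ∑ i ∈ Finset.range (r n + 1), (n.choose i : ℝ) :=
    calc ((n - 1).choose (r n) : ℝ) ≤ n.choose (r n) := by
          exact_mod_cast Nat.choose_le_choose _ (Nat.sub_le _ _)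
      _ ≤ _ := Finset.single_le_sum (f := fun i => (n.choose i : ℝ))
          (fun _ _ => by positivity) (Finset.self_mem_range_succ _)
  have hb := hc.trans_le hball
  rw [← div_mul_div_cancel₀ hc.ne' (a := krawt (n - 1) (r n) (S.card - 1))]
  have hτ1 := (div_le_one hb).2 hball
  have hτ0 := (div_pos hc hb).le
  generalize ((n - 1).choose (r n) : ℝ) / ∑ i ∈ Finset.range (r n + 1), (n.choose i : ℝ) = τ at *
  have hmul : ∀ (κ : ℝ) (j : ℕ), κ ≤ (1 - 2 * β) ^ j + ε / 2 →
      κ * τ ≤ (1 - 2 * β) ^ j * (1 - 2 * β) + ε := by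
    intro κ j hκ
    have hj : 0 ≤ (1 - 2 * β) ^ j := pow_nonneg hρ j
    have hj1 : (1 - 2 * β) ^ j ≤ 1 := pow_le_one₀ hρ (by linarith)
    calc κ * τ ≤ ((1 - 2 * β) ^ j + ε / 2) * τ := mul_le_mul_of_nonneg_right hκ hτ0
      _ ≤ (1 - 2 * β) ^ j * (1 - 2 * β + ε / 2) + ε / 2 * 1 := by
        rw [add_mul]
        gcongr
      _ ≤ _ := by nlinarith
  by_cases hk : 2 * (S.card - 1) ≤ n - 1
  · have h := hmul _ (S.card - 1) (sub_le_iff_le_add'.1 (abs_le.1 (hn _ hk)).2)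
    rw [← pow_succ, Nat.sub_add_cancel hpos] at h
    linarith
  · have hsub : n - 1 - (S.card - 1) = n - S.card := by omega
    rw [krawt_reflect _ (by omega : S.card - 1 ≤ n - 1), hsub]
    have h := abs_le.1 (hn (n - S.card) (by omega))
    rcases Nat.even_or_odd (r n) with he | ho
    · rw [he.neg_one_pow, one_mul]
      have h' := hmul _ (n - S.card) (sub_le_iff_le_add'.1 h.2)
      nlinarith [mul_le_mul_of_nonneg_right (ht n he) hp']
    · rw [ho.neg_one_pow, neg_one_mul, neg_div]
      have : -(krawt (n - 1) (r n) (n - S.card) / ((n - 1).choose (r n) : ℝ)) ≤ ε / 2 := by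
        linarith [h.1]
      have := mul_le_mul_of_nonneg_right this hτ0
      nlinarith

/-- Uniform noise on a set `B` compared with i.i.d. noise, through Fourier coefficients. -/
theorem uniform_noise_le {n : ℕ} {B : Finset (Fin n → ℤˣ)} {β t ε : ℝ} (hβ0 : 0 ≤ β)
    (hβ : β ≤ 1 / 2) (ht : 0 ≤ t)
    (h : ∀ S : Finset (Fin n), (∑ z ∈ B, cubeChar S z) / B.card ≤
        (1 - 2 * β) ^ S.card + t * (1 - 2 * β) ^ (n - S.card) + ε)
    (f : (Fin n → ℤˣ) → ℝ) (hf : ∀ x, 0 ≤ f x) :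
    (∑ x, ∑ z ∈ B, f x * f (x * z)) / (2 ^ n * B.card) ≤
      (1 + t) * Stab n β f + ε * ((∑ x, f x ^ 2) / 2 ^ n) := by
  set w : (Fin n → ℤˣ) → ℝ := fun z => ∏ i, if z i = 1 then 1 - β else β with hw
  have hw0 : ∀ z, 0 ≤ w z := fun z => Finset.prod_nonneg fun i _ => by split_ifs <;> linarith
  set c : (Fin n → ℤˣ) → ℝ := fun z =>
    (if z ∈ B then (1 : ℝ) else 0) / B.card - w z - t * (w z * cubeChar Finset.univ z) with hc
  have hBsum : ∀ g : (Fin n → ℤˣ) → ℝ, ∑ z ∈ B, g z = ∑ z, if z ∈ B then g z else 0 :=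
    fun g => by simp
  have hcoef : ∀ S, ∑ z, c z * cubeChar S z ≤ ε := by
    intro S
    have hB : ∑ z, (if z ∈ B then (1 : ℝ) else 0) / B.card * cubeChar S z =
        (∑ z ∈ B, cubeChar S z) / B.card := by
      rw [hBsum, Finset.sum_div]
      refine Finset.sum_congr rfl fun z _ => ?_
      split_ifs <;> simp [div_eq_inv_mul]
    have h1 := sum_noise_cubeChar β S
    have h2 := sum_noise_cubeChar_univ β S
    have hsplit : ∑ z, c z * cubeChar S z =
        ∑ z, (if z ∈ B then (1 : ℝ) else 0) / B.card * cubeChar S z -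
          ∑ z, w z * cubeChar S z - t * ∑ z, w z * cubeChar Finset.univ z * cubeChar S z := by
      rw [Finset.mul_sum, ← Finset.sum_sub_distrib, ← Finset.sum_sub_distrib]
      exact Finset.sum_congr rfl fun z _ => by simp only [hc]; ring
    rw [hsplit, hB, h1, h2]
    linarith [h S]
  have hmain := sum_kernel_le hcoef f
  have hexpand : ∑ x, ∑ z, c z * (f x * f (x * z)) =
      (∑ x, ∑ z ∈ B, f x * f (x * z)) / B.card - ∑ x, ∑ z, w z * (f x * f (x * z)) -
        t * ∑ x, ∑ z, w z * cubeChar Finset.univ z * (f x * f (x * z)) := by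
    rw [Finset.mul_sum, Finset.sum_div, ← Finset.sum_sub_distrib, ← Finset.sum_sub_distrib]
    refine Finset.sum_congr rfl fun x _ => ?_
    rw [Finset.mul_sum, hBsum, Finset.sum_div,
      ← Finset.sum_sub_distrib, ← Finset.sum_sub_distrib]
    refine Finset.sum_congr rfl fun z _ => ?_
    simp only [hc]
    split_ifs <;> ring
  have htwist : ∑ x, ∑ z, w z * cubeChar Finset.univ z * (f x * f (x * z)) ≤
      ∑ x, ∑ z, w z * (f x * f (x * z)) := by
    refine Finset.sum_le_sum fun x _ => Finset.sum_le_sum fun z _ => ?_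
    have hchar : cubeChar Finset.univ z ≤ 1 := by
      refine (le_abs_self _).trans (le_of_eq ?_)
      rw [cubeChar, Finset.abs_prod]
      refine Finset.prod_eq_one fun i _ => ?_
      rcases Int.units_eq_one_or (z i) with h | h <;> simp [h]
    have := mul_nonneg (hw0 z) (mul_nonneg (hf x) (hf (x * z)))
    nlinarith
  have hfinal : (∑ x, ∑ z ∈ B, f x * f (x * z)) / B.card ≤
      (1 + t) * ∑ x, ∑ z, w z * (f x * f (x * z)) + ε * ∑ x, f x ^ 2 := by
    have := mul_le_mul_of_nonneg_left htwist ht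
    linarith
  have h2 : (0 : ℝ) < 2 ^ n := by positivity
  rw [mul_comm ((2 : ℝ) ^ n), ← div_div, Stab, ← mul_div_assoc, ← mul_div_assoc, ← add_div]
  exact div_le_div_of_nonneg_right hfinal h2.le

theorem uniform_noise_indic_le {n : ℕ} {B : Finset (Fin n → ℤˣ)} {α β t ε : ℝ} (hα1 : α ≤ 1)
    (hβ0 : 0 ≤ β) (hβ : β ≤ 1 / 2) (ht : 0 ≤ t) (hε : 0 ≤ ε)
    (h : ∀ S : Finset (Fin n), (∑ z ∈ B, cubeChar S z) / B.card ≤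
        (1 - 2 * β) ^ S.card + t * (1 - 2 * β) ^ (n - S.card) + ε)
    {A : Finset (Fin n → ℤˣ)} (hA : (A.card : ℝ) ≤ α * 2 ^ n) :
    (∑ x, ∑ z ∈ B, indic n A x * indic n A (x * z)) / (2 ^ n * B.card) ≤
      (1 + t) * α ^ (1 / (1 - β)) + ε := by
  have h2 : (0 : ℝ) < 2 ^ n := by positivity
  have hb : 0 ≤ 1 / (1 - β) := one_div_nonneg.2 (by linarith)
  have hdens : (A.card : ℝ) / 2 ^ n ≤ α := (div_le_iff₀ h2).2 hA
  have hsq : ∑ x, indic n A x ^ 2 = A.card := by simp [indic]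
  refine (uniform_noise_le hβ0 hβ ht h _ (indic_nonneg A)).trans ?_
  rw [hsq]
  have hs := (stab_indic_le hβ0 hβ n A).trans
    (Real.rpow_le_rpow (by positivity) hdens hb)
  have h3 := mul_le_mul_of_nonneg_left hs (by linarith : 0 ≤ 1 + t)
  have h4 := mul_le_mul_of_nonneg_left (hdens.trans hα1) hε
  linarith

theorem limsup_le_of_forall_pos {u : ℕ → ℝ} {c : ℝ} (hu : ∀ n, 0 ≤ u n)
    (h : ∀ ε > 0, ∀ᶠ n in atTop, u n ≤ c + ε) : limsup u atTop ≤ c :=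
  le_of_forall_pos_le_add fun ε hε =>
    limsup_le_of_le (isCoboundedUnder_le_of_le atTop hu) (h ε hε)

theorem limsup_GammaS_le {r : ℕ → ℕ} {α β t : ℝ} (hα0 : 0 < α) (hα1 : α ≤ 1) (hβ0 : 0 < β)
    (hβ : β ≤ 1 / 2) (ht0 : 0 ≤ t) (hr : Tendsto (fun n => (r n : ℝ) / n) atTop (𝓝 β))
    (ht : ∀ n, Even (r n) → 1 ≤ t) :
    limsup (fun n : ℕ => GammaS n ⌊α * 2 ^ n⌋₊ (r n)) atTop ≤ (1 + t) * α ^ (1 / (1 - β)) := by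
  refine limsup_le_of_forall_pos (fun n => Real.sSup_nonneg ?_) fun ε hε => ?_
  · rintro y ⟨A, -, rfl⟩
    exact div_nonneg (Finset.sum_nonneg fun x _ => Finset.sum_nonneg fun z _ =>
      mul_nonneg (indic_nonneg A _) (indic_nonneg A _)) (by positivity)
  filter_upwards [eventually_sphere_eigenvalue_le hβ0 hβ ht0 hr ht hε] with n hn
  refine Real.sSup_le ?_ (by positivity)
  rintro y ⟨A, hA, rfl⟩
  refine uniform_noise_indic_le hα1 hβ0.le hβ ht0 hε.le hn ?_
  rw [hA]
  exact Nat.floor_le (by positivity)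

theorem limsup_GammaB_le {r : ℕ → ℕ} {α β t : ℝ} (hα0 : 0 < α) (hα1 : α ≤ 1) (hβ0 : 0 < β)
    (hβ : β ≤ 1 / 2) (ht0 : 0 ≤ t) (hr : Tendsto (fun n => (r n : ℝ) / n) atTop (𝓝 β))
    (ht : ∀ n, Even (r n) → 1 - 2 * β ≤ t) :
    limsup (fun n : ℕ => GammaB n ⌊α * 2 ^ n⌋₊ (r n)) atTop ≤ (1 + t) * α ^ (1 / (1 - β)) := by
  refine limsup_le_of_forall_pos (fun n => Real.sSup_nonneg ?_) fun ε hε => ?_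
  · rintro y ⟨A, -, rfl⟩
    exact div_nonneg (Finset.sum_nonneg fun x _ => Finset.sum_nonneg fun z _ =>
      mul_nonneg (indic_nonneg A _) (indic_nonneg A _)) (by positivity)
  filter_upwards [eventually_ball_eigenvalue_le hβ0 hβ ht0 hr ht hε] with n hn
  refine Real.sSup_le ?_ (by positivity)
  rintro y ⟨A, hA, rfl⟩
  refine uniform_noise_indic_le hα1 hβ0.le hβ ht0 hε.le hn ?_
  rw [hA]
  exact Nat.floor_le (by positivity)

theorem tendsto_two_mul_floor_ratio {β : ℝ} (hβ0 : 0 < β) :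
    Tendsto (fun n : ℕ => ((2 * ⌊β * n / 2⌋₊ : ℕ) : ℝ) / n) atTop (𝓝 β) := by
  have h := (tendsto_nat_floor_mul_div_atTop (R := ℝ) (half_pos hβ0).le).comp
    tendsto_natCast_atTop_atTop
  have h2 := h.const_mul 2
  rw [mul_div_cancel₀ β two_ne_zero] at h2
  refine h2.congr fun n => ?_
  simp only [Function.comp_apply]
  push_cast
  rw [mul_div_assoc, div_mul_eq_mul_div]

theorem tendsto_two_mul_floor_add_one_ratio {β : ℝ} (hβ0 : 0 < β) :
    Tendsto (fun n : ℕ => ((2 * ⌊β * n / 2⌋₊ + 1 : ℕ) : ℝ) / n) atTop (𝓝 β) := by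
  have h := (tendsto_two_mul_floor_ratio hβ0).add (tendsto_const_div_natCast tendsto_id 1)
  rw [add_zero] at h
  refine h.congr fun n => ?_
  push_cast
  rw [add_div]
  rfl

/-- hypercontractivity upper bounds, Theorem 6: for `0 < α, β ≤ 1/2`,
the asymptotic sphere/ball noise stabilities are bounded by (multiples of) `α^{1/(1−β)}`. -/
theorem hypercontractivity_upper_bounds (α β : ℝ) (hα1 : 0 < α) (hα2 : α ≤ 1 / 2)
    (hβ1 : 0 < β) (hβ2 : β ≤ 1 / 2) :
    limsup (fun n : ℕ => GammaS n ⌊α * 2 ^ n⌋₊ (2 * ⌊β * n / 2⌋₊ + 1)) atTop ≤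
        α ^ ((1 : ℝ) / (1 - β)) ∧
    limsup (fun n : ℕ => GammaB n ⌊α * 2 ^ n⌋₊ (2 * ⌊β * n / 2⌋₊ + 1)) atTop ≤
        α ^ ((1 : ℝ) / (1 - β)) ∧
    limsup (fun n : ℕ => GammaS n ⌊α * 2 ^ n⌋₊ (2 * ⌊β * n / 2⌋₊)) atTop ≤
        2 * α ^ ((1 : ℝ) / (1 - β)) ∧
    limsup (fun n : ℕ => GammaB n ⌊α * 2 ^ n⌋₊ (2 * ⌊β * n / 2⌋₊)) atTop ≤
        2 * (1 - β) * α ^ ((1 : ℝ) / (1 - β)) := by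
  have hα : α ≤ 1 := by linarith
  have heven := tendsto_two_mul_floor_ratio hβ1
  have hodd := tendsto_two_mul_floor_add_one_ratio hβ1
  have hnot : ∀ n : ℕ, ¬ Even (2 * ⌊β * n / 2⌋₊ + 1) := fun n => by simp
  refine ⟨?_, ?_, ?_, ?_⟩
  · exact (limsup_GammaS_le hα1 hα hβ1 hβ2 le_rfl hodd
      fun n h => absurd h (hnot n)).trans_eq (by ring)
  · exact (limsup_GammaB_le hα1 hα hβ1 hβ2 le_rfl hodd
      fun n h => absurd h (hnot n)).trans_eq (by ring)
  · exact (limsup_GammaS_le hα1 hα hβ1 hβ2 zero_le_one heven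
      fun _ _ => le_rfl).trans_eq (by ring)
  · exact (limsup_GammaB_le hα1 hα hβ1 hβ2 (by linarith : 0 ≤ 1 - 2 * β) heven
      fun _ _ => le_rfl).trans_eq (by ring)
end
end

section
/- For all integers n ≥ 1 and all integers 0 ≤ k ≤ n and 0 ≤ i ≤ n, one has K_k^(n)(0) ≥ |K_k^(n)(i)|, where K_k^(n)(0) = C(n,k). -/
noncomputable section

/-- Generalized binomial coefficient `C(x, j) = x(x-1)⋯(x-j+1)/j!` for real `x`. -/
def rchoose (x : ℝ) (j : ℕ) : ℝ := (∏ i ∈ Finset.range j, (x - i)) / (Nat.factorial j)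

/-- Krawtchouk polynomial `K_k^(n)(x) = Σ_{j=0}^k (-1)^j C(x,j) C(n-x, k-j)`. -/
def kraw (n k : ℕ) (x : ℝ) : ℝ :=
  ∑ j ∈ Finset.range (k + 1), (-1 : ℝ) ^ j * rchoose x j * rchoose ((n : ℝ) - x) (k - j)

theorem rchoose_natCast (m j : ℕ) : rchoose (m : ℝ) j = m.choose j := by
  rw [rchoose, ← descPochhammer_eval_eq_prod_range, descPochhammer_eval_eq_descFactorial,
    Nat.descFactorial_eq_factorial_mul_choose]
  push_cast
  exact mul_div_cancel_left₀ _ (by positivity)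

theorem kraw_natCast {n i : ℕ} (k : ℕ) (hi : i ≤ n) :
    kraw n k i =
      ∑ j ∈ Finset.range (k + 1), (-1 : ℝ) ^ j * i.choose j * (n - i).choose (k - j) := by
  simp only [kraw, ← Nat.cast_sub hi, rchoose_natCast]

theorem kraw_zero (n k : ℕ) : kraw n k 0 = n.choose k := by
  rw [← Nat.cast_zero, kraw_natCast k n.zero_le, Finset.sum_range_succ']
  simp

/-- Vandermonde's identity bounds the alternating sum termwise. -/
theorem abs_kraw_natCast_le {n i : ℕ} (k : ℕ) (hi : i ≤ n) : |kraw n k i| ≤ n.choose k := by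
  have vandermonde : (n.choose k : ℝ) =
      ∑ j ∈ Finset.range (k + 1), (i.choose j : ℝ) * (n - i).choose (k - j) := by
    conv_lhs => rw [← Nat.add_sub_cancel' hi, Nat.add_choose_eq,
      Finset.Nat.sum_antidiagonal_eq_sum_range_succ_mk]
    push_cast
    rfl
  rw [kraw_natCast k hi, vandermonde]
  refine (Finset.abs_sum_le_sum_abs _ _).trans_eq (Finset.sum_congr rfl fun j _ => ?_)
  simp [abs_mul]

/-- Lemma 1, part 1: for `0 ≤ k, i ≤ n`,
`K_k^(n)(0) ≥ |K_k^(n)(i)|`, where `K_k^(n)(0) = C(n,k)`. -/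
theorem kraw_zero_extremal (n k i : ℕ) (hn : 1 ≤ n) (hk : k ≤ n) (hi : i ≤ n) :
    kraw n k 0 = (n.choose k : ℝ) ∧ |kraw n k (i : ℝ)| ≤ kraw n k 0 := by
  exact ⟨kraw_zero n k, (abs_kraw_natCast_le k hi).trans_eq (kraw_zero n k).symm⟩
end
end

section
/- For all integers n ≥ 1, all integers 0 ≤ k ≤ (n−1)/2, and all integers 1 ≤ i ≤ n−1, one has K_k^(n)(1) ≥ |K_k^(n)(i)|. -/
noncomputable section

open Polynomial

/-- The coefficient of `X ^ k` in `(1 - X) ^ i * (1 + X) ^ l`. -/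
def genCoeff (i l k : ℕ) : ℝ := ((1 - X : ℝ[X]) ^ i * (1 + X) ^ l).coeff k

theorem rchoose_natCast_s11 (n j : ℕ) : rchoose n j = n.choose j := by
  rw [rchoose, Nat.cast_choose_eq_descPochhammer_div, descPochhammer_eval_eq_prod_range]

theorem coeff_comp_neg_X (p : ℝ[X]) (k : ℕ) : (p.comp (-X)).coeff k = (-1) ^ k * p.coeff k := by
  rw [show (-X : ℝ[X]) = C (-1) * X by simp, comp_C_mul_X_coeff, mul_comm]

theorem coeff_one_sub_X_pow (i j : ℕ) :
    ((1 - X : ℝ[X]) ^ i).coeff j = (-1) ^ j * i.choose j := by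
  have h : (1 - X : ℝ[X]) ^ i = ((1 + X : ℝ[X]) ^ i).comp (-X) := by
    simp [sub_eq_add_neg]
  rw [h, coeff_comp_neg_X, coeff_one_add_X_pow]

theorem kraw_eq_genCoeff (i l k : ℕ) : kraw (i + l) k i = genCoeff i l k := by
  have h : ((i + l : ℕ) : ℝ) - i = (l : ℕ) := by push_cast; ring
  rw [genCoeff, coeff_mul, Finset.Nat.sum_antidiagonal_eq_sum_range_succ_mk, kraw, h]
  simp only [rchoose_natCast_s11, coeff_one_sub_X_pow, coeff_one_add_X_pow]

theorem genCoeff_zero (i l : ℕ) : genCoeff i l 0 = 1 := by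
  simp [genCoeff, coeff_zero_eq_eval_zero]

theorem genCoeff_succ_right (i l k : ℕ) :
    genCoeff i (l + 1) (k + 1) = genCoeff i l (k + 1) + genCoeff i l k := by
  have h : (1 - X : ℝ[X]) ^ i * (1 + X) ^ (l + 1) =
      (1 - X) ^ i * (1 + X) ^ l + (1 - X) ^ i * (1 + X) ^ l * X := by ring
  rw [genCoeff, h, coeff_add, coeff_mul_X, genCoeff, genCoeff]

theorem genCoeff_swap (i l k : ℕ) : genCoeff i l k = (-1) ^ k * genCoeff l i k := by
  have h : (1 - X : ℝ[X]) ^ i * (1 + X) ^ l = ((1 - X : ℝ[X]) ^ l * (1 + X) ^ i).comp (-X) := by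
    simp only [mul_comp, pow_comp, sub_comp, add_comp, one_comp, X_comp]
    ring
  rw [genCoeff, h, coeff_comp_neg_X, genCoeff]

theorem abs_genCoeff_swap (i l k : ℕ) : |genCoeff i l k| = |genCoeff l i k| := by
  rw [genCoeff_swap, abs_mul, abs_pow, abs_neg, abs_one, one_pow, one_mul]

theorem genCoeff_one_nonneg {m k : ℕ} (h : 2 * k ≤ m) : 0 ≤ genCoeff 1 m k := by
  cases k with
  | zero => simp [genCoeff_zero]
  | succ k =>
    have e : (1 - X : ℝ[X]) ^ 1 * (1 + X) ^ m = (1 + X) ^ m - (1 + X) ^ m * X := by ring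
    rw [genCoeff, e, coeff_sub, coeff_mul_X, coeff_one_add_X_pow, coeff_one_add_X_pow, sub_nonneg]
    exact_mod_cast Nat.choose_le_succ_of_lt_half_left (by omega)

theorem reflect_pow_of_natDegree_le_one {p : ℝ[X]} (hp : p.natDegree ≤ 1) (n : ℕ) :
    reflect n (p ^ n) = reflect 1 p ^ n := by
  induction n with
  | zero => simp
  | succ n ih =>
    rw [pow_succ, reflect_mul _ _ ((natDegree_pow_le_of_le n hp).trans_eq (mul_one n)) hp, ih,
      pow_succ]

/-- `(1 - X) ^ i * (1 + X) ^ l` is palindromic up to the sign `(-1) ^ i`. -/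
theorem genCoeff_reflect {i l p q : ℕ} (h : p + q = i + l) :
    genCoeff i l p = (-1) ^ i * genCoeff i l q := by
  have hsub : (1 - X : ℝ[X]).natDegree ≤ 1 := by compute_degree
  have hadd : (1 + X : ℝ[X]).natDegree ≤ 1 := by compute_degree
  have rX : reflect 1 (X : ℝ[X]) = 1 := reflect_one_X
  have r1 : reflect 1 (1 : ℝ[X]) = X := by simp
  have key : reflect (i + l) ((1 - X : ℝ[X]) ^ i * (1 + X) ^ l) =
      C ((-1) ^ i) * ((1 - X) ^ i * (1 + X) ^ l) := by
    rw [reflect_mul _ _ ((natDegree_pow_le_of_le i hsub).trans_eq (mul_one i))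
      ((natDegree_pow_le_of_le l hadd).trans_eq (mul_one l)),
      reflect_pow_of_natDegree_le_one hsub, reflect_pow_of_natDegree_le_one hadd,
      reflect_sub, reflect_add, rX, r1, ← mul_assoc, C_pow, ← mul_pow]
    simp only [C_neg, C_1]
    ring
  have := congrArg (fun f => coeff f q) key
  simp only [coeff_reflect, coeff_C_mul] at this
  rwa [revAt_le (by omega), ← h, Nat.add_sub_cancel] at this

/-- The absolute value of the central coefficient of `(1 - X) ^ (2 * a) * (1 + X) ^ (2 * b)`;
these are the super Catalan numbers. -/
def superCatalan (a b : ℕ) : ℝ := (2 * a).factorial * (2 * b).factorial /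
  (a.factorial * b.factorial * (a + b).factorial)

theorem superCatalan_pos (a b : ℕ) : 0 < superCatalan a b := by
  unfold superCatalan; positivity

theorem superCatalan_comm (a b : ℕ) : superCatalan a b = superCatalan b a := by
  unfold superCatalan
  rw [add_comm a b]
  ring

theorem superCatalan_succ_left (a b : ℕ) :
    superCatalan (a + 1) b = 2 * (2 * a + 1) / (a + b + 1) * superCatalan a b := by
  have e : a + 1 + b = (a + b) + 1 := by ring
  have e' : 2 * (a + 1) = 2 * a + 1 + 1 := by ring
  unfold superCatalan
  rw [e, e']
  simp only [Nat.factorial_succ]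
  push_cast
  field_simp
  ring

theorem superCatalan_succ_right (a b : ℕ) :
    superCatalan a (b + 1) = 2 * (2 * b + 1) / (a + b + 1) * superCatalan a b := by
  rw [superCatalan_comm, superCatalan_succ_left, superCatalan_comm, add_comm (b : ℝ)]

theorem superCatalan_le_of_le {a b : ℕ} (hab : a + 1 ≤ b) :
    superCatalan (a + 1) b ≤ superCatalan a (b + 1) := by
  have h : (a : ℝ) + 1 ≤ b := by exact_mod_cast hab
  rw [superCatalan_succ_left, superCatalan_succ_right]
  have := (superCatalan_pos a b).le
  gcongr
  linarith

theorem superCatalan_le_one_of_le (a b : ℕ) (hab : a ≤ b) :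
    superCatalan (a + 1) (b + 1) ≤ superCatalan 1 (a + b + 1) := by
  induction a generalizing b with
  | zero => simp
  | succ a ih =>
    refine (superCatalan_le_of_le (by omega)).trans ((ih (b + 1) (by omega)).trans_eq ?_)
    congr 1
    omega

theorem superCatalan_le_one (a b : ℕ) :
    superCatalan (a + 1) (b + 1) ≤ superCatalan 1 (a + b + 1) := by
  rcases le_total a b with h | h
  · exact superCatalan_le_one_of_le a b h
  · rw [superCatalan_comm, add_comm a b]
    exact superCatalan_le_one_of_le b a h

theorem genCoeff_central (a b : ℕ) :
    genCoeff (2 * a) (2 * b) (a + b) = (-1) ^ a * superCatalan a b := by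
  induction a generalizing b with
  | zero =>
    simp only [genCoeff, mul_zero, pow_zero, one_mul, zero_add, coeff_one_add_X_pow, superCatalan,
      Nat.factorial_zero, Nat.cast_one]
    rw [two_mul, Nat.cast_add_choose]
  | succ a ih =>
    have h : (1 - X : ℝ[X]) ^ (2 * (a + 1)) * (1 + X) ^ (2 * b) =
        (1 - X) ^ (2 * a) * (1 + X) ^ (2 * (b + 1)) -
          C 4 * ((1 - X) ^ (2 * a) * (1 + X) ^ (2 * b) * X) := by
      rw [show (C 4 : ℝ[X]) = 4 from rfl]
      ring
    have e : a + 1 + b = a + b + 1 := by ring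
    have h1 := ih b
    have h2 := ih (b + 1)
    rw [← add_assoc] at h2
    rw [genCoeff] at h1 h2
    rw [genCoeff, h, e, coeff_sub, coeff_C_mul, coeff_mul_X, h1, h2, superCatalan_succ_left,
      superCatalan_succ_right]
    field_simp
    ring

theorem abs_genCoeff_near_central {a l k : ℕ} (b : ℕ) (hl : l + 1 = 2 * b) (hk : a + b = k + 1) :
    |genCoeff (2 * a) l k| = superCatalan a b / 2 := by
  have h1 := genCoeff_central a b
  rw [← hl, hk, genCoeff_succ_right,
    genCoeff_reflect (i := 2 * a) (l := l) (p := k + 1) (q := k) (by omega),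
    pow_mul, neg_one_sq, one_pow, one_mul] at h1
  have h2 : genCoeff (2 * a) l k = (-1) ^ a * superCatalan a b / 2 := by linarith
  rw [h2, abs_div, abs_mul, abs_pow, abs_neg, abs_one, one_pow, one_mul,
    abs_of_pos (superCatalan_pos a b), abs_two]

theorem abs_genCoeff_le_of_even {a l k : ℕ} (ha : 1 ≤ a) (hl : 1 ≤ l) (h : 2 * a + l = 2 * k + 1) :
    |genCoeff (2 * a) l k| ≤ genCoeff 1 (2 * k) k := by
  obtain ⟨a, rfl⟩ := Nat.exists_eq_add_of_le' ha
  obtain ⟨b, rfl⟩ : ∃ b, k = a + b + 1 := ⟨k - a - 1, by omega⟩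
  rw [← abs_of_nonneg (genCoeff_one_nonneg (le_refl (2 * (a + b + 1)))), abs_genCoeff_swap 1,
    abs_genCoeff_near_central (b + 1) (by omega) (by omega),
    abs_genCoeff_near_central 1 (by omega) (by omega), superCatalan_comm _ 1]
  have := superCatalan_le_one a b
  linarith

theorem abs_genCoeff_le_of_add_eq {i l k : ℕ} (hi : 1 ≤ i) (hl : 1 ≤ l) (h : i + l = 2 * k + 1) :
    |genCoeff i l k| ≤ genCoeff 1 (2 * k) k := by
  rcases Nat.even_or_odd' i with ⟨a, rfl | rfl⟩
  · exact abs_genCoeff_le_of_even (by omega) hl h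
  · obtain ⟨b, rfl⟩ : ∃ b, l = 2 * b := ⟨k - a, by omega⟩
    rw [abs_genCoeff_swap]
    exact abs_genCoeff_le_of_even (by omega) hi (by omega)

theorem abs_genCoeff_le (i l k : ℕ) (h : 2 * k ≤ i + l + 1) :
    |genCoeff (i + 1) (l + 1) k| ≤ genCoeff 1 (i + l + 1) k := by
  induction l generalizing k with
  | zero =>
    rw [abs_genCoeff_swap]
    exact (abs_of_nonneg (genCoeff_one_nonneg h)).le
  | succ l ih =>
    rcases h.eq_or_lt with h | h
    · rw [← h]
      exact abs_genCoeff_le_of_add_eq (by omega) (by omega) (by omega)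
    · cases k with
      | zero => simp [genCoeff_zero]
      | succ k =>
        rw [genCoeff_succ_right _ (l + 1), show i + (l + 1) + 1 = i + l + 1 + 1 by ring,
          genCoeff_succ_right 1]
        exact (abs_add_le _ _).trans (add_le_add (ih _ (by omega)) (ih _ (by omega)))

/-- Lemma 1, part 2: for `0 ≤ k ≤ (n−1)/2` and `1 ≤ i ≤ n−1`,
`K_k^(n)(1) ≥ |K_k^(n)(i)|`. -/
theorem kraw_one_extremal (n k i : ℕ) (hn : 1 ≤ n) (hk : (k : ℝ) ≤ ((n : ℝ) - 1) / 2)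
    (hi1 : 1 ≤ i) (hi2 : i ≤ n - 1) :
    |kraw n k (i : ℝ)| ≤ kraw n k 1 := by
  obtain ⟨i, rfl⟩ := Nat.exists_eq_add_of_le' hi1
  obtain ⟨l, rfl⟩ : ∃ l, n = (i + 1) + (l + 1) := ⟨n - i - 2, by omega⟩
  have hk' : 2 * k + 1 ≤ (i + 1) + (l + 1) := by
    have : (2 * k + 1 : ℝ) ≤ ((i + 1) + (l + 1) : ℕ) := by linarith
    exact_mod_cast this
  have h1 : kraw ((i + 1) + (l + 1)) k 1 = genCoeff 1 (i + l + 1) k := by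
    rw [← kraw_eq_genCoeff, Nat.cast_one]
    congr 1
    ring
  rw [kraw_eq_genCoeff, h1]
  exact abs_genCoeff_le i l k (by omega)
end
end

section
/- For every δ with 0 < δ < 1/2 and every ε > 0, there exists N such that for all n ≥ N and all integers r with 0 ≤ r ≤ (1/2 − δ)n, setting β := r/n, one has |C(n,≤r)/C(n,r) − Σ_{j=0}^r (β/(1−β))^j| ≤ ε. In other words, C(n,≤r)/C(n,r) → Σ_{j=0}^r (β/(1−β))^j uniformly over all β = r/n ∈ [0, 1/2 − δ] as n → ∞. -/
noncomputable section

/-- Each ratio `C(r+s, r-j) / C(r+s, r)`, written with `k = r - j`, is close to `(r/s)^j`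
from below. -/
lemma choose_ratio_bounds {r s : ℕ} (hs : 0 < s) (hrs : r ≤ s) {q : ℝ}
    (hq : (r : ℝ) / s ≤ q) (j k : ℕ) (hk : k + j = r) :
    ((r + s).choose k : ℝ) / (r + s).choose r ≤ ((r : ℝ) / s) ^ j ∧
    (((r : ℝ) / s) ^ j - ((r + s).choose k : ℝ) / (r + s).choose r) * q ≤ j ^ 2 * q ^ j / s := by
  have hC : (0 : ℝ) < (r + s).choose r := by exact_mod_cast Nat.choose_pos (by omega)
  have hs' : (0 : ℝ) < s := by exact_mod_cast hs
  have hrs' : (r : ℝ) ≤ s := by exact_mod_cast hrs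
  have hx0 : (0 : ℝ) ≤ (r : ℝ) / s := by positivity
  have hq0 : 0 ≤ q := hx0.trans hq
  induction j generalizing k with
  | zero =>
    obtain rfl : k = r := by omega
    simp [div_self hC.ne']
  | succ j ih =>
    obtain ⟨hle, hbd⟩ := ih (k + 1) (by omega)
    have hrec : ((r + s).choose (k + 1) : ℝ) * (k + 1) = (r + s).choose k * (s + j + 1) := by
      have h := Nat.choose_succ_right_eq (r + s) k
      rw [show r + s - k = s + j + 1 by omega] at h
      exact_mod_cast h
    have hkr : (k : ℝ) + (j + 1) = r := by exact_mod_cast hk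
    have hj0 : (0 : ℝ) ≤ j := j.cast_nonneg
    have hk0 : (0 : ℝ) ≤ k := k.cast_nonneg
    have hden : (0 : ℝ) < s + j + 1 := by positivity
    set x : ℝ := (r : ℝ) / s with hx
    set a : ℝ := ((r + s).choose (k + 1) : ℝ) / (r + s).choose r with ha
    set t : ℝ := ((k : ℝ) + 1) / (s + j + 1) with ht
    have hstep : ((r + s).choose k : ℝ) / (r + s).choose r = a * t := by
      rw [ha, ht, div_mul_div_comm, hrec, mul_comm ((r + s).choose r : ℝ),
        mul_comm ((r + s).choose k : ℝ), mul_div_mul_left _ _ hden.ne']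
    have ha0 : 0 ≤ a := by positivity
    have ht0 : 0 ≤ t := by positivity
    have htx : t ≤ x := by
      rw [ht, hx, div_le_div_iff₀ hden hs']
      nlinarith
    have hxt : x - t ≤ (2 * j + 1) / s := by
      rw [sub_le_iff_le_add, hx, ht, div_add_div _ _ hs'.ne' hden.ne',
        div_le_div_iff₀ hs' (by positivity)]
      have : (r : ℝ) * (s + j + 1) ≤ (2 * j + 1) * (s + j + 1) + s * (k + 1) := by
        have : (k : ℝ) = r - (j + 1) := by linarith
        rw [this]
        nlinarith
      nlinarith
    have haq : a ≤ q ^ j := hle.trans (pow_le_pow_left₀ hx0 hq j)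
    rw [hstep]
    constructor
    · rw [pow_succ]
      exact mul_le_mul hle htx ht0 (by positivity)
    · have h1 : x * ((x ^ j - a) * q) ≤ q * (j ^ 2 * q ^ j / s) :=
        mul_le_mul hq hbd (mul_nonneg (sub_nonneg.2 hle) hq0) hq0
      have h2 : a * (x - t) ≤ q ^ j * ((2 * j + 1) / s) :=
        mul_le_mul haq hxt (sub_nonneg.2 htx) (by positivity)
      calc (x ^ (j + 1) - a * t) * q = x * ((x ^ j - a) * q) + a * (x - t) * q := by ring
        _ ≤ q * (j ^ 2 * q ^ j / s) + q ^ j * ((2 * j + 1) / s) * q :=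
          add_le_add h1 (mul_le_mul_of_nonneg_right h2 hq0)
        _ = ((j + 1 : ℕ) : ℝ) ^ 2 * q ^ (j + 1) / s := by push_cast; ring

/-- Lemma 4, part 2: `C(n,≤r)/C(n,r) → Σ_{j=0}^r (β/(1−β))^j`
uniformly over all `β = r/n ∈ [0, 1/2 − δ]` as `n → ∞`. -/
theorem ball_sphere_ratio_uniform (δ : ℝ) (hδ1 : 0 < δ) (hδ2 : δ < 1 / 2)
    (ε : ℝ) (hε : 0 < ε) :
    ∃ N : ℕ, ∀ n ≥ N, ∀ r : ℕ, (r : ℝ) ≤ (1 / 2 - δ) * n →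
      |(ballBinom n r : ℝ) / (n.choose r : ℝ)
          - ∑ j ∈ Finset.range (r + 1), (((r : ℝ) / n) / (1 - (r : ℝ) / n)) ^ j| ≤ ε := by
  set q : ℝ := (1 / 2 - δ) / (1 / 2 + δ) with hqdef
  have hq0 : 0 < q := div_pos (by linarith) (by linarith)
  have hq1 : q < 1 := by rw [hqdef, div_lt_one (by linarith)]; linarith
  have hsum : Summable fun j : ℕ => (j : ℝ) ^ 2 * q ^ j :=
    summable_pow_mul_geometric_of_norm_lt_one 2 (by rwa [Real.norm_of_nonneg hq0.le])
  set S : ℝ := ∑' j : ℕ, (j : ℝ) ^ 2 * q ^ j with hS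
  obtain ⟨N, hN⟩ := exists_nat_gt (2 * S / (q * ε))
  refine ⟨max N 1, fun n hn r hr => ?_⟩
  have hnpos : (0 : ℝ) < n := by exact_mod_cast (le_max_right N 1).trans hn
  have hNn : (N : ℝ) ≤ n := by exact_mod_cast (le_max_left N 1).trans hn
  have hrn : 2 * r ≤ n := by
    have : (2 : ℝ) * r ≤ n := by nlinarith
    exact_mod_cast this
  obtain ⟨s, rfl⟩ := Nat.exists_eq_add_of_le (show r ≤ n by omega)
  have hrs : r ≤ s := by omega
  push_cast at hnpos hNn hr
  have hrs' : (r : ℝ) ≤ s := by exact_mod_cast hrs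
  have hs : (0 : ℝ) < s := by linarith
  have hx : ((r : ℝ) / (r + s : ℕ)) / (1 - (r : ℝ) / (r + s : ℕ)) = r / s := by
    push_cast
    rw [one_sub_div hnpos.ne', add_sub_cancel_left, div_div_div_cancel_right₀ hnpos.ne']
  have hxq : (r : ℝ) / s ≤ q := by
    rw [hqdef, div_le_div_iff₀ hs (by linarith)]
    linarith
  have hbd := choose_ratio_bounds (by exact_mod_cast hs) hrs hxq
  have hball : (ballBinom (r + s) r : ℝ) / ((r + s).choose r : ℝ)
      = ∑ j ∈ Finset.range (r + 1), ((r + s).choose (r - j) : ℝ) / (r + s).choose r := by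
    rw [ballBinom, ← Finset.sum_range_reflect, Nat.cast_sum, Finset.sum_div]
    simp
  have hdiff : |(ballBinom (r + s) r : ℝ) / ((r + s).choose r : ℝ)
      - ∑ j ∈ Finset.range (r + 1), ((r : ℝ) / s) ^ j| * q ≤ S / s := by
    rw [hball, abs_sub_comm, ← Finset.sum_sub_distrib, abs_of_nonneg, Finset.sum_mul]
    · calc _ ≤ ∑ j ∈ Finset.range (r + 1), (j : ℝ) ^ 2 * q ^ j / s :=
            Finset.sum_le_sum fun j hj =>
              (hbd j (r - j) (Nat.sub_add_cancel (Finset.mem_range_succ_iff.1 hj))).2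
        _ ≤ S / s := by
            rw [← Finset.sum_div]
            gcongr
            exact hsum.sum_le_tsum _ fun j _ => by positivity
    · exact Finset.sum_nonneg fun j hj => sub_nonneg.2
        (hbd j (r - j) (Nat.sub_add_cancel (Finset.mem_range_succ_iff.1 hj))).1
  rw [hx]
  refine le_of_mul_le_mul_right (hdiff.trans ?_) hq0
  rw [div_le_iff₀ hs]
  have h2 : 2 * S < (r + s) * (q * ε) :=
    (div_lt_iff₀ (mul_pos hq0 hε)).1 (hN.trans_le hNn)
  nlinarith [mul_pos hq0 hε]
end
end
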